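/- arXiv:1609.00933 — 4 statements merged into one kernel-verified Lean document; each statement's English description precedes it below -/
import Mathlib

section
/- Every compact graph-like space is regular, i.e. it has a basis of open sets each of which has finite topological boundary. -/
open Set Topology Filter Function

universe u

/-- A compact graph-like space structure on a topological space `X`:
a closed zero-dimensional vertex set `V` together with an index type `E`
(carrying the discrete topology) such that `X \ V ≅ E × (0,1)`. -/
structure GraphLike (X : Type u) [TopologicalSpace X] where
  V : Set X
  closedV : IsClosed V
  zeroDimV : TotallyDisconnectedSpace V
  E : Type
  homeo :
    letI : TopologicalSpace E := ⊥
    Nonempty ((Vᶜ : Set X) ≃ₜ (E × ↥(Set.Ioo (0 : ℝ) 1)))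

variable {X : Type u} [TopologicalSpace X]

/-- An edge of a graph-like space: a connected component of `X \ V`. -/
def GraphLike.IsEdge (G : GraphLike X) (e : Set X) : Prop :=
  ∃ x, x ∈ (G.V)ᶜ ∧ e = connectedComponentIn (G.V)ᶜ x

/-- A subset of the vertex set which is clopen in the subspace `V`. -/
def GraphLike.ClopenIn (G : GraphLike X) (C : Set X) : Prop :=
  C ⊆ G.V ∧ IsClosed C ∧ IsClosed (G.V \ C)

/-- A separation of a graph-like space: a partition of the vertex set into
two disjoint clopen pieces. -/
structure GraphLike.Separation (G : GraphLike X) where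
  A : Set X
  B : Set X
  clopenA : G.ClopenIn A
  clopenB : G.ClopenIn B
  disjoint : A ∩ B = ∅
  union : A ∪ B = G.V

/-- The cut induced by a pair of vertex sets: all edges whose closure meets both. -/
def GraphLike.cut (G : GraphLike X) (A B : Set X) : Set (Set X) :=
  {e | G.IsEdge e ∧ (closure e ∩ A).Nonempty ∧ (closure e ∩ B).Nonempty}

/-- A cut is even if it is finite of even cardinality. -/
def GraphLike.EvenCut (G : GraphLike X) (A B : Set X) : Prop :=
  (G.cut A B).Finite ∧ Even (G.cut A B).ncard


lemma aux_Icc_compact (a b : ↥(Set.Ioo (0 : ℝ) 1)) : IsCompact (Icc a b) := by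
  rw [Subtype.isCompact_iff]
  have : (Subtype.val '' Icc a b : Set ℝ) = Icc a.1 b.1 := by
    ext x
    constructor
    · rintro ⟨y, hy, rfl⟩
      exact hy
    · intro hx
      exact ⟨⟨x, lt_of_lt_of_le a.2.1 hx.1, lt_of_le_of_lt hx.2 b.2.2⟩, hx, rfl⟩
  rw [this]
  exact isCompact_Icc

lemma aux_finite {E : Type} (F : Set E) (hF : F.Finite) (Y : Type*)
    (g : E × ↥(Set.Ioo (0 : ℝ) 1) → Y) (a b : ↥(Set.Ioo (0 : ℝ) 1)) :
    (g '' (F ×ˢ Icc a b) \ g '' (F ×ˢ Ioo a b)).Finite := by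
  refine ((hF.prod (Set.toFinite {a, b})).image g).subset ?_
  rintro _ ⟨⟨⟨e, t⟩, ⟨he, ht⟩, rfl⟩, h⟩
  refine ⟨(e, t), ⟨he, ?_⟩, rfl⟩
  by_contra hn
  simp only [mem_insert_iff, mem_singleton_iff, not_or] at hn
  exact h ⟨(e, t), ⟨he, lt_of_le_of_ne ht.1 (Ne.symm hn.1), lt_of_le_of_ne ht.2 hn.2⟩, rfl⟩

lemma aux_main {X : Type*} [TopologicalSpace X] [CompactSpace X] [T2Space X]
    (V : Set X) (hV : IsClosed V) [TotallyDisconnectedSpace V]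
    {E : Type} [TopologicalSpace E] [DiscreteTopology E]
    (g : E × ↥(Set.Ioo (0 : ℝ) 1) → X) (hg : IsOpenEmbedding g) (hr : range g = Vᶜ)
    (x : X) (U : Set X) (hU : IsOpen U) (hx : x ∈ U) :
    ∃ W, IsOpen W ∧ x ∈ W ∧ W ⊆ U ∧ (frontier W).Finite := by
  have hLc : ∀ (F : Set E), F.Finite → ∀ a b, IsCompact (g '' (F ×ˢ Icc a b)) := fun F hF a b =>
    (hF.isCompact.prod (aux_Icc_compact a b)).image hg.continuous
  have hMo : ∀ (F : Set E) a b, IsOpen (g '' (F ×ˢ Ioo a b)) := fun F a b =>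
    hg.isOpenMap _ ((isOpen_discrete F).prod isOpen_Ioo)
  by_cases hxV : x ∈ V
  · haveI : CompactSpace V := isCompact_iff_compactSpace.mp hV.isCompact
    obtain ⟨C, hC, hxC, hCU⟩ := compact_exists_isClopen_in_isOpen
      (hU.preimage (continuous_subtype_val : Continuous (Subtype.val : V → X)))
      (x := ⟨x, hxV⟩) hx
    have h1 : IsCompact (Subtype.val '' C : Set X) :=
      hC.isClosed.isCompact.image continuous_subtype_val
    have h2 : IsCompact (Subtype.val '' Cᶜ : Set X) :=
      hC.compl.isClosed.isCompact.image continuous_subtype_val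
    have hd : Disjoint (Subtype.val '' C : Set X) (Subtype.val '' Cᶜ) :=
      (disjoint_image_iff Subtype.val_injective).2 disjoint_compl_right
    obtain ⟨O1, O2, ho1, ho2, hs1, hs2, hdO⟩ := SeparatedNhds.of_isCompact_isCompact h1 h2 hd
    have hKc : IsCompact ((O1 ∩ U) ∪ O2)ᶜ :=
      ((ho1.inter hU).union ho2).isClosed_compl.isCompact
    have hKV : ((O1 ∩ U) ∪ O2)ᶜ ⊆ range g := by
      rw [hr, compl_subset_compl]
      intro v hv
      by_cases hvC : (⟨v, hv⟩ : V) ∈ C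
      · exact Or.inl ⟨hs1 ⟨_, hvC, rfl⟩, hCU hvC⟩
      · exact Or.inr (hs2 ⟨_, hvC, rfl⟩)
    have hK' : IsCompact (g ⁻¹' ((O1 ∩ U) ∪ O2)ᶜ) :=
      (hg.isInducing.isCompact_preimage_iff hKV).2 hKc
    have hF := (hK'.image continuous_fst).finite_of_discrete
    have hS := hK'.image continuous_snd
    haveI : Nonempty ↥(Set.Ioo (0 : ℝ) 1) := ⟨⟨1/2, by norm_num, by norm_num⟩⟩
    obtain ⟨a, ha⟩ := hS.bddBelow
    obtain ⟨b, hb⟩ := hS.bddAbove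
    set F := Prod.fst '' (g ⁻¹' ((O1 ∩ U) ∪ O2)ᶜ) with hFdef
    have hKL : ((O1 ∩ U) ∪ O2)ᶜ ⊆ g '' (F ×ˢ Icc a b) := by
      intro y hy
      obtain ⟨z, rfl⟩ := hKV hy
      exact ⟨z, ⟨⟨z, hy, rfl⟩, ha ⟨z, hy, rfl⟩, hb ⟨z, hy, rfl⟩⟩, rfl⟩
    have hL := (hLc F hF a b).isClosed
    have hWo : IsOpen ((O1 ∩ U) \ g '' (F ×ˢ Icc a b)) := (ho1.inter hU).sdiff hL
    refine ⟨_, hWo, ⟨⟨hs1 ⟨_, hxC, rfl⟩, hx⟩, ?_⟩, fun y hy => hy.1.2, ?_⟩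
    · rintro ⟨z, -, hz⟩
      have : x ∈ range g := ⟨z, hz⟩
      rw [hr] at this
      exact this hxV
    · refine (aux_finite F hF X g a b).subset ?_
      rw [hWo.frontier_eq]
      rintro y ⟨hyc, hyn⟩
      constructor
      · by_contra hyL
        have hy2 : y ∈ O2 := by
          by_contra hy2
          have : y ∉ O1 ∩ U := fun h => hyn ⟨h, hyL⟩
          exact hyL (hKL (fun h => h.elim this hy2))
        obtain ⟨w, hw2, hw⟩ := mem_closure_iff.1 hyc O2 ho2 hy2
        exact disjoint_left.1 hdO hw.1.1 hw2
      · intro hyM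
        obtain ⟨w, hw2, hw⟩ := mem_closure_iff.1 hyc _ (hMo F a b) hyM
        exact hw.2 (image_mono (prod_mono subset_rfl Ioo_subset_Icc_self) hw2)
  · have : x ∈ range g := by rw [hr]; exact hxV
    obtain ⟨⟨e, t⟩, rfl⟩ := this
    have hc : Continuous fun s : ↥(Set.Ioo (0 : ℝ) 1) => g (e, s) :=
      hg.continuous.comp (by fun_prop)
    have hn : (fun s : ↥(Set.Ioo (0 : ℝ) 1) => g (e, s)) ⁻¹' U ∈ 𝓝 t :=
      (hU.preimage hc).mem_nhds hx
    have hlo : ∃ l, l < t := ⟨⟨t.1 / 2, by have := t.2.1; have := t.2.2; constructor <;> linarith⟩,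
      Subtype.coe_lt_coe.1 (by have := t.2.1; simp only; linarith)⟩
    have hhi : ∃ l, t < l := ⟨⟨(t.1 + 1) / 2, by
      have := t.2.1; have := t.2.2; constructor <;> linarith⟩,
      Subtype.coe_lt_coe.1 (by have := t.2.2; simp only; linarith)⟩
    obtain ⟨a, b, hab, hsub⟩ := (mem_nhds_iff_exists_Ioo_subset' hlo hhi).1 hn
    have hWo := hMo {e} a b
    refine ⟨_, hWo, ⟨(e, t), ⟨rfl, hab⟩, rfl⟩, ?_, ?_⟩
    · rintro _ ⟨⟨e', s⟩, ⟨he, hs⟩, rfl⟩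
      obtain rfl : e' = e := he
      exact hsub hs
    · refine (aux_finite {e} (finite_singleton e) X g a b).subset ?_
      rw [hWo.frontier_eq]
      exact sdiff_subset_sdiff_left (closure_minimal
        (image_mono (prod_mono subset_rfl Ioo_subset_Icc_self))
        (hLc {e} (finite_singleton e) a b).isClosed)

/-- Every compact graph-like space is regular: it has a basis of open
sets each of which has finite boundary. -/
theorem graphLike_regular [CompactSpace X] [TopologicalSpace.MetrizableSpace X]
    (G : GraphLike X) :
    ∃ B : Set (Set X), TopologicalSpace.IsTopologicalBasis B ∧
      ∀ U ∈ B, (frontier U).Finite := by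
  refine ⟨{W | IsOpen W ∧ (frontier W).Finite}, ?_, fun U hU => hU.2⟩
  letI : TopologicalSpace G.E := ⊥
  haveI : DiscreteTopology G.E := ⟨rfl⟩
  haveI := G.zeroDimV
  obtain ⟨φ⟩ := G.homeo
  have hg : IsOpenEmbedding (fun p => (φ.symm p : X)) :=
    G.closedV.isOpen_compl.isOpenEmbedding_subtypeVal.comp φ.symm.isOpenEmbedding
  have hr : range (fun p => (φ.symm p : X)) = (G.V)ᶜ := by
    ext y
    constructor
    · rintro ⟨p, rfl⟩
      exact (φ.symm p).2
    · intro hy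
      exact ⟨φ ⟨y, hy⟩, by simp⟩
  refine TopologicalSpace.isTopologicalBasis_of_isOpen_of_nhds (fun U hU => hU.1) ?_
  intro x U hx hU
  obtain ⟨W, h1, h2, h3, h4⟩ := aux_main G.V G.closedV _ hg hr x U hU hx
  exact ⟨W, ⟨h1, h4⟩, h2, h3⟩
end

section
/- Every graph-like continuum is finitely Souslian, hereditarily locally connected, and arc-connected. -/
open Set Topology Filter Function

universe u

variable {X : Type u} [TopologicalSpace X]

/-- Rim-finite: a basis of open sets with finite frontier. -/
def RimFin (Y : Type*) [TopologicalSpace Y] : Prop :=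
  ∀ x : Y, ∀ U : Set Y, IsOpen U → x ∈ U →
    ∃ W : Set Y, IsOpen W ∧ x ∈ W ∧ W ⊆ U ∧ (frontier W).Finite

theorem RimFin.subtype {Y : Type*} [TopologicalSpace Y] (h : RimFin Y) (A : Set Y) : RimFin A := by
  rintro x U hU hx
  obtain ⟨U', hU', rfl⟩ := isOpen_induced_iff.1 hU
  obtain ⟨W, hW, hxW, hWU, hf⟩ := h x.1 U' hU' hx
  refine ⟨Subtype.val ⁻¹' W, hW.preimage continuous_subtype_val, hxW, preimage_mono hWU, ?_⟩
  exact (hf.preimage Subtype.val_injective.injOn).subset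
    (continuous_subtype_val.frontier_preimage_subset W)

theorem RimFin.nhds_conn {Y : Type*} [TopologicalSpace Y] [CompactSpace Y] [T2Space Y]
    [ConnectedSpace Y] (h : RimFin Y) (x : Y) (U : Set Y) (hU : IsOpen U) (hx : x ∈ U) :
    ∃ C : Set Y, C ∈ 𝓝 x ∧ C ⊆ U ∧ IsPreconnected C ∧ x ∈ C := by
  obtain ⟨U', hU', hxU', hcl⟩ := normal_exists_closure_subset (isClosed_singleton (x := x)) hU
    (singleton_subset_iff.2 hx)
  obtain ⟨W, hW, hxW, hWU, hf⟩ := h x U' hU' (hxU' rfl)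
  have hK : IsClosed (closure W) := isClosed_closure
  have : CompactSpace (closure W) := isCompact_iff_compactSpace.1 hK.isCompact
  let x' : closure W := ⟨x, subset_closure hxW⟩
  have hopen : IsOpen (connectedComponent x') := by
    let B : Set (closure W) := Subtype.val ⁻¹' (frontier W) \ connectedComponent x'
    have hB : B.Finite := (hf.preimage Subtype.val_injective.injOn).subset sdiff_subset
    have h1 : ∀ b : closure W, b ∉ connectedComponent x' → ∃ D : Set (closure W), IsClopen D ∧
        x' ∈ D ∧ b ∉ D := by
      intro b hb
      rw [connectedComponent_eq_iInter_isClopen] at hb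
      simp only [mem_iInter, not_forall] at hb
      obtain ⟨⟨D, hD, hD2⟩, h3⟩ := hb
      exact ⟨D, hD, hD2, h3⟩
    choose! D hD hxD hbD using h1
    have hDc : IsClopen (⋂ b ∈ B, D b) := hB.isClopen_biInter fun b hb => hD b hb.2
    have hxDc : x' ∈ ⋂ b ∈ B, D b := mem_iInter₂.2 fun b hb => hxD b hb.2
    have : connectedComponent x' = ⋂ b ∈ B, D b := by
      apply Subset.antisymm (hDc.connectedComponent_subset hxDc)
      intro z hz
      by_contra hzC
      set Z : Set (closure W) := (D z)ᶜ ∩ ⋂ b ∈ B, D b with hZ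
      have hZc : IsClopen Z := (hD z hzC).compl.inter hDc
      have hzZ : z ∈ Z := ⟨hbD z hzC, hz⟩
      have hxZ : x' ∉ Z := fun h => h.1 (hxD z hzC)
      have hZW : ∀ b ∈ Z, b.1 ∈ W := by
        intro b hb
        by_contra hbW
        have hbf : b.1 ∈ frontier W := by
          rw [hW.frontier_eq]; exact ⟨b.2, hbW⟩
        by_cases hbC : b ∈ connectedComponent x'
        · exact hb.1 ((hD z hzC).connectedComponent_subset (hxD z hzC) hbC)
        · exact hbD b hbC (mem_iInter₂.1 hb.2 b ⟨hbf, hbC⟩)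
      have hcl : IsClosed (Subtype.val '' Z) := hK.isClosedEmbedding_subtypeVal.isClosedMap _ hZc.1
      have hop : IsOpen (Subtype.val '' Z) := by
        obtain ⟨O, hO, hOZ⟩ := isOpen_induced_iff.1 hZc.2
        have : Subtype.val '' Z = O ∩ W := by
          ext a
          constructor
          · rintro ⟨b, hb, rfl⟩
            refine ⟨?_, hZW b hb⟩
            rw [← hOZ] at hb; exact hb
          · rintro ⟨ha, haW⟩
            refine ⟨⟨a, subset_closure haW⟩, ?_, rfl⟩
            rw [← hOZ]; exact ha
        rw [this]; exact hO.inter hW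
      rcases isClopen_iff.1 (⟨hcl, hop⟩ : IsClopen (Subtype.val '' Z)) with h0 | h0
      · exact (h0 ▸ mem_image_of_mem _ hzZ : z.1 ∈ (∅ : Set Y))
      · have : x ∈ Subtype.val '' Z := h0 ▸ mem_univ x
        obtain ⟨b, hb, hbx⟩ := this
        exact hxZ ((Subtype.ext hbx : b = x') ▸ hb)
    rw [this]; exact hDc.2
  refine ⟨Subtype.val '' connectedComponent x', ?_, ?_,
    isPreconnected_connectedComponent.image _ continuous_subtype_val.continuousOn,
    ⟨x', mem_connectedComponent, rfl⟩⟩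
  · obtain ⟨O, hO, hOZ⟩ := isOpen_induced_iff.1 hopen
    refine mem_of_superset ((hO.inter hW).mem_nhds ⟨?_, hxW⟩) ?_
    · have : x' ∈ Subtype.val ⁻¹' O := hOZ ▸ mem_connectedComponent
      exact this
    · rintro a ⟨ha, haW⟩
      refine ⟨⟨a, subset_closure haW⟩, ?_, rfl⟩
      rw [← hOZ]; exact ha
  · rintro _ ⟨b, _, rfl⟩
    exact hcl (closure_mono hWU b.2)

theorem RimFin.locallyConnected {Y : Type*} [TopologicalSpace Y] [CompactSpace Y] [T2Space Y]
    [ConnectedSpace Y] (h : RimFin Y) : LocallyConnectedSpace Y := by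
  rw [locallyConnectedSpace_iff_connectedComponentIn_open]
  intro F hF x hx
  rw [isOpen_iff_mem_nhds]
  intro y hy
  obtain ⟨C, hC, hCF, hCc, hyC⟩ := h.nhds_conn y F hF (connectedComponentIn_subset F x hy)
  rw [connectedComponentIn_eq hy]
  exact mem_of_superset hC (hCc.subset_connectedComponentIn hyC hCF)

theorem RimFin.souslian {Y : Type*} [MetricSpace Y] [CompactSpace Y] (h : RimFin Y)
    (A : ℕ → Set Y) (hne : ∀ n, (A n).Nonempty)
    (hc : ∀ n, IsConnected (A n)) (hd : Pairwise (Function.onFun Disjoint A)) :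
    Tendsto (fun n => Metric.diam (A n)) atTop (𝓝 0) := by
  rw [Metric.tendsto_atTop]
  intro ε hε
  have := fun x : Y => h x (Metric.ball x (ε / 4)) Metric.isOpen_ball
    (Metric.mem_ball_self (by positivity))
  choose W hW hxW hWU hf using this
  obtain ⟨t, ht⟩ := isCompact_univ.elim_finite_subcover W hW
    (fun x _ => mem_iUnion.2 ⟨x, hxW x⟩)
  let F : Set Y := ⋃ x ∈ t, frontier (W x)
  have hF : F.Finite := t.finite_toSet.biUnion fun x _ => hf x
  have key : ∀ n, ε ≤ Metric.diam (A n) → (A n ∩ F).Nonempty := by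
    intro n hn
    obtain ⟨a, ha⟩ := hne n
    obtain ⟨x, hx, hax⟩ := mem_iUnion₂.1 (ht (mem_univ a))
    have hns : ¬ A n ⊆ W x := by
      intro hs
      have h1 := Metric.diam_mono (hs.trans (hWU x)) Metric.isBounded_ball
      have h2 := Metric.diam_ball (x := x) (r := ε / 4) (by positivity)
      linarith
    by_contra hemp
    have hsub : A n ⊆ W x ∪ (closure (W x))ᶜ := by
      intro b hb
      by_contra hb2
      simp only [mem_union, mem_compl_iff, not_or, not_not] at hb2
      refine hemp ⟨b, hb, mem_iUnion₂.2 ⟨x, hx, ?_⟩⟩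
      rw [(hW x).frontier_eq]; exact ⟨hb2.2, hb2.1⟩
    rcases (hc n).isPreconnected.subset_or_subset (hW x) isClosed_closure.isOpen_compl
      (disjoint_compl_right.mono_left subset_closure) hsub with h1 | h1
    · exact hns h1
    · exact h1 ha (subset_closure hax)
  have hfin : {n | ε ≤ Metric.diam (A n)}.Finite := by
    have : Nonempty Y := ⟨(hne 0).some⟩
    choose! g hg using key
    refine Set.Finite.of_finite_image (f := g) (hF.subset ?_) ?_
    · rintro _ ⟨n, hn, rfl⟩; exact (hg n hn).2
    · intro n hn m hm hnm
      by_contra hne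
      exact (disjoint_left.1 (hd hne) (hg n hn).1) (hnm ▸ (hg m hm).1)
  obtain ⟨N, hN⟩ := hfin.bddAbove
  refine ⟨N + 1, fun n hn => ?_⟩
  rw [Real.dist_0_eq_abs, abs_of_nonneg Metric.diam_nonneg]
  by_contra hcon
  have : n ≤ N := hN (not_lt.1 hcon)
  omega

theorem RimFin.of_graphLike {Y : Type u} [TopologicalSpace Y] [CompactSpace Y] [T2Space Y]
    (G : GraphLike Y) : RimFin Y := by
  have hE : ∀ x : Y, x ∉ G.V → ∀ U : Set Y, IsOpen U → x ∈ U →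
    ∃ W : Set Y, IsOpen W ∧ x ∈ W ∧ W ⊆ U ∧ (frontier W).Finite := by
    intro x hx U hU hxU
    let : TopologicalSpace G.E := ⊥
    have : DiscreteTopology G.E := ⟨rfl⟩
    obtain ⟨φ⟩ := G.homeo
    have hVo : IsOpen G.Vᶜ := G.closedV.isOpen_compl
    -- parametrisation of the edge
    let e := (φ ⟨x, hx⟩).1
    let t := (φ ⟨x, hx⟩).2
    let ψ : Ioo (0 : ℝ) 1 → Y := fun s => (φ.symm (e, s)).1
    have hemb : IsOpenEmbedding ψ := by
      have h1 : IsOpenEmbedding (fun s : Ioo (0 : ℝ) 1 => (e, s)) := by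
        refine ⟨⟨⟨?_⟩, fun a b hab => (Prod.ext_iff.1 hab).2⟩, ?_⟩
        · exact (isEmbedding_prodMkRight e).eq_induced
        · have : range (fun s : Ioo (0 : ℝ) 1 => (e, s)) = Prod.fst ⁻¹' {e} := by
            ext ⟨a, b⟩; simp [eq_comm]
          rw [this]
          exact (isOpen_discrete {e}).preimage continuous_fst
      exact hVo.isOpenEmbedding_subtypeVal.comp (φ.symm.isOpenEmbedding.comp h1)
    have hψt : ψ t = x := by
      change (φ.symm (φ ⟨x, hx⟩)).1 = x
      simp
    have hpre : ψ ⁻¹' U ∈ 𝓝 t := hemb.continuous.continuousAt.preimage_mem_nhds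
      (by rw [hψt]; exact hU.mem_nhds hxU)
    rw [nhds_subtype_eq_comap, Filter.mem_comap] at hpre
    obtain ⟨S, hS, hSU⟩ := hpre
    obtain ⟨δ, hδ, hδS⟩ := Metric.mem_nhds_iff.1
      (Filter.inter_mem hS (isOpen_Ioo.mem_nhds t.2))
    have hr : Icc (t.1 - δ / 2) (t.1 + δ / 2) ⊆ S ∩ Ioo (0 : ℝ) 1 := by
      intro s hs
      apply hδS
      rw [Metric.mem_ball, Real.dist_eq, abs_lt]
      constructor <;> linarith [hs.1, hs.2]
    let I : Set (Ioo (0 : ℝ) 1) := Subtype.val ⁻¹' Ioo (t.1 - δ / 2) (t.1 + δ / 2)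
    let J : Set (Ioo (0 : ℝ) 1) := Subtype.val ⁻¹' Icc (t.1 - δ / 2) (t.1 + δ / 2)
    have hJ : IsCompact J := by
      apply Topology.IsInducing.subtypeVal.isCompact_preimage'  isCompact_Icc
      rw [Subtype.range_coe]
      exact fun s hs => (hr hs).2
    have hIJ : I ⊆ J := preimage_mono Ioo_subset_Icc_self
    have hcl : closure (ψ '' I) ⊆ ψ '' J :=
      closure_minimal (image_mono hIJ) (hJ.image hemb.continuous).isClosed
    have hopen : IsOpen (ψ '' I) :=
      hemb.isOpenMap _ (isOpen_Ioo.preimage continuous_subtype_val)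
    refine ⟨ψ '' I, hopen, ⟨t, ⟨by linarith, by linarith⟩, hψt⟩, ?_, ?_⟩
    · rintro _ ⟨s, hs, rfl⟩
      exact hSU (hr (hIJ hs)).1
    · rw [hopen.frontier_eq]
      have hfin : (Subtype.val ⁻¹' ({t.1 - δ / 2, t.1 + δ / 2} : Set ℝ) :
        Set (Ioo (0 : ℝ) 1)).Finite := (Set.toFinite _).preimage Subtype.val_injective.injOn
      refine (hfin.image ψ).subset ?_
      rintro y ⟨hy, hyI⟩
      obtain ⟨s, hs, rfl⟩ := hcl hy
      refine ⟨s, ?_, rfl⟩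
      by_contra hs2
      simp only [mem_preimage, mem_insert_iff, mem_singleton_iff, not_or] at hs2
      exact hyI ⟨s, ⟨lt_of_le_of_ne hs.1 (Ne.symm hs2.1), lt_of_le_of_ne hs.2 hs2.2⟩, rfl⟩
  intro x U hU hxU
  by_cases hx : x ∈ G.V
  swap
  · exact hE x hx U hU hxU
  have := G.zeroDimV
  have : CompactSpace G.V := isCompact_iff_compactSpace.1 G.closedV.isCompact
  obtain ⟨A, hA, hxA, hAU⟩ := compact_exists_isClopen_in_isOpen
    (hU.preimage (continuous_subtype_val : Continuous (Subtype.val : G.V → Y)))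
    (x := ⟨x, hx⟩) hxU
  have hce := G.closedV.isClosedEmbedding_subtypeVal
  have hA1 : IsClosed (Subtype.val '' A) := hce.isClosedMap _ hA.1
  have hA2 : IsClosed (Subtype.val '' Aᶜ) := hce.isClosedMap _ hA.compl.1
  obtain ⟨O, hO, hAO, hOc⟩ := normal_exists_closure_subset hA1
    (t := U ∩ (Subtype.val '' Aᶜ)ᶜ) (hU.inter hA2.isOpen_compl) (by
      rintro _ ⟨a, ha, rfl⟩
      refine ⟨hAU ha, ?_⟩
      rintro ⟨b, hb, hba⟩
      exact hb (Subtype.ext hba ▸ ha))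
  have hfr : ∀ y ∈ frontier O, y ∉ G.V := by
    intro y hy hyV
    rw [hO.frontier_eq] at hy
    by_cases hyA : (⟨y, hyV⟩ : G.V) ∈ A
    · exact hy.2 (hAO ⟨_, hyA, rfl⟩)
    · exact (hOc hy.1).2 ⟨_, hyA, rfl⟩
  have hfU : ∀ y ∈ frontier O, y ∈ U := fun y hy => (hOc (frontier_subset_closure hy)).1
  have := fun y (hy : y ∈ frontier O) => hE y (hfr y hy) U hU (hfU y hy)
  choose! D hD hyD hDU hDf using this
  obtain ⟨t, ht, htc⟩ := (isClosed_frontier (s := O)).isCompact.elim_nhds_subcover D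
    (fun y hy => (hD y hy).mem_nhds (hyD y hy))
  have hO' : IsOpen (O ∪ ⋃ y ∈ t, D y) :=
    hO.union (isOpen_biUnion fun y hy => hD y (ht y hy))
  refine ⟨O ∪ ⋃ y ∈ t, D y, hO', Or.inl (hAO ⟨_, hxA, rfl⟩), ?_, ?_⟩
  · refine union_subset (fun y hy => (hOc (subset_closure hy)).1) (iUnion₂_subset fun y hy => ?_)
    exact hDU y (ht y hy)
  · refine Set.Finite.subset (t.finite_toSet.biUnion fun y hy => hDf y (ht y hy)) ?_
    rw [hO'.frontier_eq, closure_union, t.closure_biUnion]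
    rintro y ⟨hy | hy, hy2⟩
    · exfalso
      apply hy2
      by_cases hyO : y ∈ O
      · exact Or.inl hyO
      · exact Or.inr (htc (by rw [hO.frontier_eq]; exact ⟨hy, hyO⟩))
    · obtain ⟨z, hz, hyz⟩ := mem_iUnion₂.1 hy
      refine mem_iUnion₂.2 ⟨z, hz, ?_⟩
      rw [(hD z (ht z hz)).frontier_eq]
      exact ⟨hyz, fun h => hy2 (Or.inr (mem_iUnion₂.2 ⟨z, hz, h⟩))⟩

theorem exists_irreducible {Y : Type*} [TopologicalSpace Y] [CompactSpace Y] [T2Space Y]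
    [ConnectedSpace Y] (x y : Y) : ∃ K : Set Y, IsClosed K ∧ IsPreconnected K ∧ x ∈ K ∧ y ∈ K ∧
      ∀ M : Set Y, M ⊆ K → IsClosed M → IsPreconnected M → x ∈ M → y ∈ M → M = K := by
  obtain ⟨K, hK⟩ := zorn_superset {K : Set Y | IsClosed K ∧ IsPreconnected K ∧ x ∈ K ∧ y ∈ K} (by
    intro c hc hchain
    rcases c.eq_empty_or_nonempty with rfl | hne
    · exact ⟨univ, ⟨isClosed_univ, isPreconnected_univ, mem_univ _, mem_univ _⟩, by simp⟩
    refine ⟨⋂₀ c, ⟨isClosed_sInter fun s hs => (hc hs).1, ?_, fun s hs => (hc hs).2.2.1,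
      fun s hs => (hc hs).2.2.2⟩, fun s hs => sInter_subset_of_mem hs⟩
    rw [isPreconnected_iff_subset_of_fully_disjoint_closed
      (isClosed_sInter fun s hs => (hc hs).1)]
    intro u v hu hv huv hd
    obtain ⟨u', v', hu', hv', huu, hvv, hd'⟩ := normal_separation hu hv hd
    have : Nonempty c := hne.to_subtype
    obtain ⟨⟨s, hs⟩, hsub⟩ := exists_subset_nhds_of_isCompact (V := fun s : c => s.1)
      (U := u' ∪ v') (by
        intro a b
        rcases hchain.total a.2 b.2 with h | h
        · exact ⟨a, subset_rfl, h⟩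
        · exact ⟨b, h, subset_rfl⟩) (fun s => (hc s.2).1.isCompact) (by
        intro z hz
        rw [← sInter_eq_iInter] at hz
        exact (hu'.union hv').mem_nhds (union_subset_union huu hvv (huv hz)))
    rcases (hc hs).2.1.subset_or_subset hu' hv' hd' hsub with h | h
    · left
      intro z hz
      rcases huv hz with h1 | h1
      · exact h1
      · exact (disjoint_left.1 hd' (h (hz s hs)) (hvv h1)).elim
    · right
      intro z hz
      rcases huv hz with h1 | h1
      · exact (disjoint_left.1 hd' (huu h1) (h (hz s hs))).elim
      · exact h1)
  refine ⟨K, hK.prop.1, hK.prop.2.1, hK.prop.2.2.1, hK.prop.2.2.2, ?_⟩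
  intro M hMK h1 h2 h3 h4
  exact Subset.antisymm hMK (hK.le_of_le ⟨h1, h2, h3, h4⟩ hMK)

theorem exists_continuum {Y : Type*} [TopologicalSpace Y] [CompactSpace Y] [T2Space Y]
    [LocallyConnectedSpace Y] (U : Set Y) (hU : IsOpen U) (hUc : IsPreconnected U) {x y : Y}
    (hx : x ∈ U) (hy : y ∈ U) :
    ∃ M : Set Y, M ⊆ U ∧ IsClosed M ∧ IsPreconnected M ∧ x ∈ M ∧ y ∈ M := by
  refine hUc.induction₂ (fun a b => ∃ M : Set Y, M ⊆ U ∧ IsClosed M ∧ IsPreconnected M ∧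
    a ∈ M ∧ b ∈ M) ?_ ?_ ?_ hx hy
  · intro z hz
    apply eventually_nhdsWithin_of_eventually_nhds
    obtain ⟨U', hU', hxU', hcl⟩ := normal_exists_closure_subset (isClosed_singleton (x := z)) hU
      (singleton_subset_iff.2 hz)
    have h1 := connectedComponentIn_mem_nhds (hU'.mem_nhds (hxU' rfl))
    filter_upwards [h1] with w hw
    refine ⟨closure (connectedComponentIn U' z), ?_, isClosed_closure,
      isPreconnected_connectedComponentIn.closure, subset_closure (mem_of_mem_nhds h1),
      subset_closure hw⟩
    exact (closure_mono (connectedComponentIn_subset _ _)).trans hcl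
  · rintro a b c - - - ⟨M, h1, h2, h3, h4, h5⟩ ⟨N, k1, k2, k3, k4, k5⟩
    exact ⟨M ∪ N, union_subset h1 k1, h2.union k2, h3.union b h5 k4 k3, Or.inl h4, Or.inr k5⟩
  · rintro a b - - ⟨M, h1, h2, h3, h4, h5⟩
    exact ⟨M, h1, h2, h3, h5, h4⟩

theorem preconn_of_union {Y : Type*} [TopologicalSpace Y] [ConnectedSpace Y] (L R : Set Y) (p : Y)
    (hL : IsClosed L) (hR : IsClosed R) (hLR : L ∪ R = univ) (hi : L ∩ R = {p}) :
    IsPreconnected L := by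
  classical
  have hp : p ∈ L ∩ R := hi ▸ rfl
  let r : Y → Y := fun z => if z ∈ L then z else p
  have hrL : ∀ z ∈ L, r z = z := fun z hz => if_pos hz
  have hrR : ∀ z ∈ R, r z = p := by
    intro z hz
    by_cases h : z ∈ L
    · have : z ∈ L ∩ R := ⟨h, hz⟩
      rw [hi] at this
      rw [hrL z h]; exact this
    · exact if_neg h
  have hc : Continuous r := by
    rw [← continuousOn_univ, ← hLR]
    exact ContinuousOn.union_of_isClosed (continuousOn_id.congr hrL)
      (continuousOn_const.congr hrR) hL hR
  have : L = r '' univ := by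
    ext z
    constructor
    · exact fun hz => ⟨z, mem_univ _, hrL z hz⟩
    · rintro ⟨w, -, rfl⟩
      by_cases h : w ∈ L
      · rwa [hrL w h]
      · simp only [r, if_neg h]; exact hp.1
  rw [this]
  exact isPreconnected_univ.image _ hc.continuousOn

theorem exists_LR {Y : Type*} [TopologicalSpace Y] [CompactSpace Y] [T2Space Y]
    [ConnectedSpace Y] [LocallyConnectedSpace Y] (x y : Y)
    (hirr : ∀ M : Set Y, IsClosed M → IsPreconnected M → x ∈ M → y ∈ M → M = univ) (p : Y) :
    ∃ L R : Set Y, IsClosed L ∧ IsClosed R ∧ IsPreconnected L ∧ IsPreconnected R ∧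
      L ∪ R = univ ∧ L ∩ R = {p} ∧ x ∈ L ∧ y ∈ R := by
  by_cases hpx : p = x
  · subst hpx
    exact ⟨{p}, univ, isClosed_singleton, isClosed_univ, isPreconnected_singleton,
      isPreconnected_univ, by simp, by simp, rfl, mem_univ _⟩
  by_cases hpy : p = y
  · subst hpy
    exact ⟨univ, {p}, isClosed_univ, isClosed_singleton, isPreconnected_univ,
      isPreconnected_singleton, by simp, by simp, mem_univ _, rfl⟩
  have hO : IsOpen ({p}ᶜ : Set Y) := isClosed_singleton.isOpen_compl
  have hxO : x ∈ ({p}ᶜ : Set Y) := fun h => hpx h.symm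
  have hyO : y ∈ ({p}ᶜ : Set Y) := fun h => hpy h.symm
  set P := connectedComponentIn ({p}ᶜ : Set Y) x with hP
  have hPo : IsOpen P := hO.connectedComponentIn
  have hpP : p ∉ P := fun h => connectedComponentIn_subset _ _ h rfl
  have hxP : x ∈ P := mem_connectedComponentIn hxO
  have hyP : y ∉ P := by
    intro hy
    obtain ⟨M, h1, h2, h3, h4, h5⟩ := exists_continuum P hPo isPreconnected_connectedComponentIn
      hxP hy
    exact hpP (h1 ((hirr M h2 h3 h4 h5) ▸ mem_univ p))
  have hL : IsClosed (P ∪ {p}) := by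
    rw [← isOpen_compl_iff, isOpen_iff_mem_nhds]
    intro z hz
    simp only [mem_compl_iff, mem_union, not_or] at hz
    have hzO : z ∈ ({p}ᶜ : Set Y) := hz.2
    have hm := hO.connectedComponentIn (x := z)
    refine mem_of_superset (hm.mem_nhds (mem_connectedComponentIn hzO)) ?_
    rintro w hw (h | h)
    · apply hz.1
      rw [hP, connectedComponentIn_eq h, ← connectedComponentIn_eq hw]
      exact mem_connectedComponentIn hzO
    · exact connectedComponentIn_subset _ _ hw h
  have hR : IsClosed Pᶜ := hPo.isClosed_compl
  have hu : (P ∪ {p}) ∪ Pᶜ = univ := by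
    ext z; by_cases h : z ∈ P <;> simp [h]
  have hi : (P ∪ {p}) ∩ Pᶜ = {p} := by
    ext z
    by_cases h : z ∈ P
    · simp [h]; rintro rfl; exact hpP h
    · simp [h]
  exact ⟨P ∪ {p}, Pᶜ, hL, hR, preconn_of_union _ _ p hL hR hu hi,
    preconn_of_union _ _ p hR hL (by rwa [union_comm]) (by rwa [inter_comm]), hu, hi, Or.inl hxP,
    hyP⟩

theorem infDist_le_of_close {Y : Type*} [MetricSpace Y] (d : Y) (s t : Set Y) (ht : t.Nonempty)
    (ε : ℝ) (h : ∀ w ∈ t, ∃ w' ∈ s, dist w w' ≤ ε) :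
    Metric.infDist d s ≤ Metric.infDist d t + ε := by
  have : Metric.infDist d s - ε ≤ Metric.infDist d t := by
    rw [Metric.le_infDist ht]
    intro w hw
    obtain ⟨w', hw', hd⟩ := h w hw
    have h1 := Metric.infDist_le_dist_of_mem hw' (x := d)
    have h2 := dist_triangle d w w'
    linarith
  linarith

theorem exists_param {Y : Type*} [MetricSpace Y] [CompactSpace Y]
    [ConnectedSpace Y] [LocallyConnectedSpace Y] (x y : Y)
    (hirr : ∀ M : Set Y, IsClosed M → IsPreconnected M → x ∈ M → y ∈ M → M = univ) :
    ∃ f : Y → ℝ, Continuous f ∧ Injective f ∧ ∀ z, f z ≤ f x ∧ f y ≤ f z := by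
  choose L R hL hR hLc hRc hu hi hxL hyR using exists_LR x y hirr
  have hpL : ∀ p, p ∈ L p := fun p => ((hi p).symm ▸ rfl : p ∈ L p ∩ R p).1
  have hpR : ∀ p, p ∈ R p := fun p => ((hi p).symm ▸ rfl : p ∈ L p ∩ R p).2
  have hmin : ∀ p (M : Set Y), IsClosed M → IsPreconnected M → x ∈ M → p ∈ M → L p ⊆ M := by
    intro p M hM hMc hxM hpM q hq
    have := hirr (M ∪ R p) (hM.union (hR p)) (hMc.union p hpM (hpR p) (hRc p)) (Or.inl hxM)
      (Or.inr (hyR p))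
    rcases (this ▸ mem_univ q : q ∈ M ∪ R p) with h | h
    · exact h
    · have : q ∈ L p ∩ R p := ⟨hq, h⟩
      rw [hi] at this
      exact this ▸ hpM
  have hmono : ∀ p q, p ∈ L q → L p ⊆ L q := fun p q h =>
    hmin p (L q) (hL q) (hLc q) (hxL q) h
  have hcross : ∀ p (M : Set Y), IsPreconnected M → (M ∩ L p).Nonempty → (M ∩ R p).Nonempty →
      p ∈ M := by
    intro p M hM h1 h2
    obtain ⟨z, hz, hz2⟩ := isPreconnected_closed_iff.1 hM (L p) (R p) (hL p) (hR p)
      (by rw [hu]; exact subset_univ _) h1 h2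
    rw [hi] at hz2
    exact hz2 ▸ hz
  have hmemR : ∀ p q, q ∉ L p → q ∈ R p := by
    intro p q h
    exact ((hu p).symm ▸ mem_univ q : q ∈ L p ∪ R p).resolve_left h
  have htot : ∀ p q, q ∉ L p → p ∈ L q := fun p q h =>
    hcross p (L q) (hLc q) ⟨x, hxL q, hxL p⟩ ⟨q, hpL q, hmemR p q h⟩
  have hanti : ∀ p q, q ∈ L p → p ∈ L q → p = q := by
    intro p q h1 h2
    have : p ∈ L q ∩ R q := ⟨h2, hcross p (R q) (hRc q) ⟨q, hpR q, h1⟩ ⟨y, hyR q, hyR p⟩⟩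
    rw [hi] at this
    exact this
  have hcont : ∀ d, Continuous fun z => Metric.infDist d (L z) := by
    intro d
    rw [Metric.continuous_iff']
    intro z ε hε
    have h1 := connectedComponentIn_mem_nhds (Metric.ball_mem_nhds z (show 0 < ε / 4 by positivity))
    set C := connectedComponentIn (Metric.ball z (ε / 4)) z
    have hC : closure C ⊆ Metric.closedBall z (ε / 4) :=
      (closure_mono (connectedComponentIn_subset _ _)).trans Metric.closure_ball_subset_closedBall
    have hCc : IsPreconnected (closure C) := isPreconnected_connectedComponentIn.closure
    have key : ∀ a ∈ closure C, ∀ b ∈ closure C,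
        Metric.infDist d (L a) ≤ Metric.infDist d (L b) + ε / 2 := by
      intro a ha b hb
      apply infDist_le_of_close _ _ _ ⟨b, hpL b⟩
      intro w hw
      have hs : L b ⊆ L a ∪ closure C := hmin b _ ((hL a).union isClosed_closure)
        ((hLc a).union a (hpL a) ha hCc) (Or.inl (hxL a)) (Or.inr hb)
      rcases hs hw with h | h
      · exact ⟨w, h, by rw [dist_self]; positivity⟩
      · refine ⟨a, hpL a, ?_⟩
        have h2 := hC h
        have h3 := hC ha
        rw [Metric.mem_closedBall] at h2 h3
        have := dist_triangle_right w a z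
        linarith
    have hz : z ∈ closure C := subset_closure (mem_of_mem_nhds h1)
    filter_upwards [h1] with a ha
    have k1 := key a (subset_closure ha) z hz
    have k2 := key z hz a (subset_closure ha)
    rw [Real.dist_eq, abs_lt]
    constructor <;> linarith
  let D : ℝ := Metric.diam (univ : Set Y)
  have : Nonempty Y := ⟨x⟩
  let d := TopologicalSpace.denseSeq Y
  let g : ℕ → Y → ℝ := fun n z => (1 / 2 : ℝ) ^ n * Metric.infDist (d n) (L z)
  have hsum : Summable fun n : ℕ => (1 / 2 : ℝ) ^ n * D := summable_geometric_two.mul_right D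
  have hbd : ∀ n z, ‖g n z‖ ≤ (1 / 2 : ℝ) ^ n * D := by
    intro n z
    rw [Real.norm_eq_abs, abs_of_nonneg (mul_nonneg (by positivity) Metric.infDist_nonneg)]
    refine mul_le_mul_of_nonneg_left ?_ (by positivity)
    exact (Metric.infDist_le_dist_of_mem (hpL z)).trans
      (Metric.dist_le_diam_of_mem isCompact_univ.isBounded (mem_univ _) (mem_univ _))
  have hgs : ∀ z, Summable fun n => g n z := fun z => Summable.of_norm_bounded hsum (fun n => hbd n z)
  have hgm : ∀ p q, p ∈ L q → ∀ n, g n q ≤ g n p := by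
    intro p q h n
    exact mul_le_mul_of_nonneg_left
      (Metric.infDist_le_infDist_of_subset (hmono p q h) ⟨p, hpL p⟩) (by positivity)
  have hle : ∀ p q, p ∈ L q → ∑' n, g n q ≤ ∑' n, g n p := fun p q h =>
    (hgs q).tsum_le_tsum (hgm p q h) (hgs p)
  have hlt : ∀ p q, q ∉ L p → ∑' n, g n q < ∑' n, g n p := by
    intro p q h
    have hpos : 0 < Metric.infDist q (L p) :=
      ((hL p).notMem_iff_infDist_pos ⟨p, hpL p⟩).1 h
    obtain ⟨n, hn⟩ := (TopologicalSpace.denseRange_denseSeq Y).exists_dist_lt q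
      (half_pos hpos)
    refine Summable.tsum_lt_tsum (hgm p q (htot p q h)) (i := n) ?_ (hgs q) (hgs p)
    refine mul_lt_mul_of_pos_left ?_ (by positivity)
    have h1 : Metric.infDist (d n) (L q) ≤ dist (d n) q := Metric.infDist_le_dist_of_mem (hpL q)
    have h2 : Metric.infDist q (L p) ≤ Metric.infDist (d n) (L p) + dist q (d n) :=
      Metric.infDist_le_infDist_add_dist
    rw [dist_comm] at h1
    change dist q (d n) < _ at hn
    linarith
  refine ⟨fun z => ∑' n, g n z, ?_, ?_, ?_⟩
  · exact continuous_tsum (fun n => continuous_const.mul (hcont (d n))) hsum hbd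
  · intro p q hpq
    by_contra hne
    by_cases h : q ∈ L p
    · by_cases h' : p ∈ L q
      · exact hne (hanti p q h h')
      · exact (hlt q p h').ne hpq
    · exact (hlt p q h).ne hpq.symm
  · intro z
    refine ⟨hle x z (hxL z), hle z y ?_⟩
    rw [hirr (L y) (hL y) (hLc y) (hxL y) (hpL y)]
    exact mem_univ z

theorem RimFin.arc {Y : Type*} [MetricSpace Y] [CompactSpace Y] [ConnectedSpace Y]
    (h : RimFin Y) (x y : Y) (hxy : x ≠ y) :
    ∃ f : unitInterval → Y, Continuous f ∧ Function.Injective f ∧ f 0 = x ∧ f 1 = y := by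
  obtain ⟨K, hK, hKc, hx, hy, hmin⟩ := exists_irreducible x y
  have : CompactSpace K := isCompact_iff_compactSpace.1 hK.isCompact
  have : ConnectedSpace K := isConnected_iff_connectedSpace.1 ⟨⟨x, hx⟩, hKc⟩
  have : LocallyConnectedSpace K := (h.subtype K).locallyConnected
  obtain ⟨f, hf, hinj, hord⟩ := exists_param (⟨x, hx⟩ : K) ⟨y, hy⟩ (by
    intro M hM hMc hxM hyM
    have := hmin (Subtype.val '' M) (by rintro _ ⟨a, _, rfl⟩; exact a.2)
      (hK.isClosedEmbedding_subtypeVal.isClosedMap _ hM)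
      (hMc.image _ continuous_subtype_val.continuousOn) ⟨_, hxM, rfl⟩ ⟨_, hyM, rfl⟩
    ext z
    refine ⟨fun _ => mem_univ _, fun _ => ?_⟩
    have hz : z.1 ∈ Subtype.val '' M := this.symm ▸ z.2
    obtain ⟨w, hw, hwz⟩ := hz
    exact Subtype.ext hwz ▸ hw)
  set a := f ⟨x, hx⟩
  set b := f ⟨y, hy⟩
  have hne : a ≠ b := fun h => hxy (congrArg Subtype.val (hinj h))
  have hemb : IsEmbedding f := (hf.isClosedEmbedding hinj).isEmbedding
  let γ : unitInterval → ℝ := fun t => a + t.1 * (b - a)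
  have hγ : Continuous γ := by fun_prop
  have hba : b ≤ a := (hord ⟨x, hx⟩).2
  have hrange : ∀ t, γ t ∈ range f := by
    intro t
    have := intermediate_value_univ (⟨y, hy⟩ : K) ⟨x, hx⟩ hf
    apply this
    have h0 := t.2.1
    have h1 := t.2.2
    constructor
    · change b ≤ a + t.1 * (b - a); nlinarith
    · change a + t.1 * (b - a) ≤ a; nlinarith
  choose g hg using hrange
  have hgc : Continuous g := by
    rw [hemb.continuous_iff]
    exact hγ.congr fun t => (hg t).symm
  refine ⟨fun t => (g t).1, continuous_subtype_val.comp hgc, ?_, ?_, ?_⟩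
  · intro s t hst
    have : γ s = γ t := by rw [← hg, ← hg, Subtype.ext hst]
    simp only [γ, add_right_inj] at this
    exact Subtype.ext (mul_right_cancel₀ (sub_ne_zero.2 hne.symm) this)
  · have : g 0 = ⟨x, hx⟩ := hinj (by rw [hg]; simp [γ, a])
    simp [this]
  · have : g 1 = ⟨y, hy⟩ := hinj (by rw [hg]; simp [γ, b])
    simp [this]

/-- Every graph-like continuum is finitely Souslian, hereditarily
locally connected, and arc-connected. -/
theorem graphLikeContinuum_souslian_hlc_arcConnected
    [CompactSpace X] [TopologicalSpace.MetrizableSpace X] [ConnectedSpace X]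
    (G : GraphLike X) :
    (∀ m : MetricSpace X, m.toUniformSpace.toTopologicalSpace = ‹TopologicalSpace X› →
      ∀ A : ℕ → Set X, (∀ n, (A n).Nonempty) → (∀ n, IsCompact (A n)) →
        (∀ n, IsConnected (A n)) → Pairwise (Function.onFun Disjoint A) →
        Filter.Tendsto (fun n => @Metric.diam X m.toPseudoMetricSpace (A n))
          Filter.atTop (nhds 0)) ∧
    (∀ A : Set X, A.Nonempty → IsCompact A → IsConnected A → LocallyConnectedSpace A) ∧
    (∀ x y : X, x ≠ y →
      ∃ f : unitInterval → X, Continuous f ∧ Function.Injective f ∧ f 0 = x ∧ f 1 = y) := by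
  have hR : RimFin X := RimFin.of_graphLike G
  refine ⟨?_, ?_, ?_⟩
  · intro m hm A h1 _ h3 h4
    subst hm
    exact hR.souslian A h1 h3 h4
  · intro A _ hA hAc
    have : CompactSpace A := isCompact_iff_compactSpace.1 hA
    have : ConnectedSpace A := isConnected_iff_connectedSpace.1 hAc
    exact (hR.subtype A).locallyConnected
  · intro x y hxy
    let _ := TopologicalSpace.metrizableSpaceMetric X
    exact hR.arc x y hxy
end

section
/- Let X be a continuum. Then X is completely regular (every subcontinuum of X with more than one point has non-empty interior in X) if and only if X is graph-like, i.e. there exist a closed zero-dimensional subset V ⊆ X and an index set E such that (X,V,E) is a compact graph-like space. -/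
open Set Topology Filter Function

universe u

variable {X : Type u} [TopologicalSpace X]

/-- A continuum as a set, possibly degenerate. -/
def Cnt {X : Type u} [TopologicalSpace X] (A : Set X) : Prop := IsClosed A ∧ IsPreconnected A

def CReg (X : Type u) [TopologicalSpace X] : Prop :=
  ∀ A : Set X, Cnt A → A.Nontrivial → (interior A).Nonempty

def Irr {X : Type u} [TopologicalSpace X] (K : Set X) (p q : X) : Prop :=
  Cnt K ∧ p ∈ K ∧ q ∈ K ∧ ∀ A ⊆ K, Cnt A → p ∈ A → q ∈ A → A = K

section helpers

set_option linter.style.haveILetI false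

variable {Y : Type u} [TopologicalSpace Y]

theorem Cnt.union {A B : Set Y} (hA : Cnt A) (hB : Cnt B) (h : (A ∩ B).Nonempty) :
    Cnt (A ∪ B) := ⟨hA.1.union hB.1, hA.2.union' h hB.2⟩

theorem Irr.symm {K : Set Y} {p q : Y} (h : Irr K p q) : Irr K q p :=
  ⟨h.1, h.2.2.1, h.2.1, fun A hA hc h1 h2 => h.2.2.2 A hA hc h2 h1⟩

theorem cnt_sInter [CompactSpace Y] [T2Space Y] {S : Set (Set Y)} (hne : S.Nonempty)
    (hS : ∀ A ∈ S, Cnt A) (hd : ∀ A ∈ S, ∀ B ∈ S, A ⊆ B ∨ B ⊆ A) : Cnt (⋂₀ S) := by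
  have hcl : IsClosed (⋂₀ S) := isClosed_sInter fun A hA => (hS A hA).1
  refine ⟨hcl, isPreconnected_closed_iff.2 ?_⟩
  intro t t' ht ht' hcov hne1 hne2
  by_contra hemp
  rw [not_nonempty_iff_eq_empty] at hemp
  have hdisj : Disjoint (⋂₀ S ∩ t) (⋂₀ S ∩ t') := by
    rw [Set.disjoint_iff_inter_eq_empty, ← hemp]; ext; simp; tauto
  obtain ⟨U, W, hU, hW, hsU, hsW, hUW⟩ :=
    normal_separation (hcl.inter ht) (hcl.inter ht') hdisj
  haveI : Nonempty S := hne.to_subtype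
  obtain ⟨A, hA⟩ : ∃ i : S, (i : Set Y) ⊆ U ∪ W := by
    apply exists_subset_nhds_of_isCompact (V := fun i : S => (i : Set Y))
    · intro a b
      rcases hd a a.2 b b.2 with h | h
      · exact ⟨a, le_rfl, h⟩
      · exact ⟨b, h, le_rfl⟩
    · intro i; exact (hS i i.2).1.isCompact
    · intro x hx
      have hx' : x ∈ ⋂₀ S := by rwa [sInter_eq_iInter]
      apply (hU.union hW).mem_nhds
      rcases hcov hx' with h | h
      · exact Or.inl (hsU ⟨hx', h⟩)
      · exact Or.inr (hsW ⟨hx', h⟩)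
  obtain ⟨x, hx⟩ := hne1
  obtain ⟨y, hy⟩ := hne2
  obtain ⟨z, -, hz⟩ := (hS A A.2).2 U W hU hW hA ⟨x, hx.1 A A.2, hsU hx⟩ ⟨y, hy.1 A A.2, hsW hy⟩
  exact Set.disjoint_left.1 hUW hz.1 hz.2

theorem bump [CompactSpace Y] [T2Space Y] {K N : Set Y} (hK : Cnt K) (hN : IsClosed N) {q : Y}
    (hq : q ∈ K) (hqN : q ∉ N) (hKN : (K ∩ N).Nonempty) :
    ∃ Q, Cnt Q ∧ q ∈ Q ∧ Q ⊆ closure (K \ N) ∧ (Q ∩ N).Nonempty := by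
  set F := closure (K \ N) with hF
  have hFc : IsClosed F := isClosed_closure
  have hFK : F ⊆ K := closure_minimal sdiff_subset hK.1
  have hqF : q ∈ F := subset_closure ⟨hq, hqN⟩
  haveI : CompactSpace F := isCompact_iff_compactSpace.1 hFc.isCompact
  let q' : F := ⟨q, hqF⟩
  refine ⟨Subtype.val '' connectedComponent q', ⟨?_, ?_⟩, ⟨q', mem_connectedComponent, rfl⟩, ?_, ?_⟩
  · exact hFc.isClosedMap_subtype_val _ isClosed_connectedComponent
  · exact isPreconnected_connectedComponent.image _ continuous_subtype_val.continuousOn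
  · rintro _ ⟨x, -, rfl⟩; exact x.2
  by_contra hemp
  have hN' : IsClosed (Subtype.val ⁻¹' N : Set F) := hN.preimage continuous_subtype_val
  obtain ⟨Z, hZ⟩ : ∃ Z : { s : Set F // IsClopen s ∧ q' ∈ s }, (Z : Set F) ⊆ (Subtype.val ⁻¹' N)ᶜ := by
    haveI : Nonempty { s : Set F // IsClopen s ∧ q' ∈ s } := ⟨⟨univ, isClopen_univ, mem_univ _⟩⟩
    apply exists_subset_nhds_of_isCompact (V := fun i : { s : Set F // IsClopen s ∧ q' ∈ s } => (i : Set F))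
    · intro a b
      exact ⟨⟨a ∩ b, a.2.1.inter b.2.1, a.2.2, b.2.2⟩, inter_subset_left, inter_subset_right⟩
    · intro i; exact i.2.1.isClosed.isCompact
    · intro x hx
      apply hN'.isOpen_compl.mem_nhds
      rw [← connectedComponent_eq_iInter_isClopen] at hx
      intro hxN
      exact hemp ⟨x, ⟨x, hx, rfl⟩, hxN⟩
  have h1 : IsClosed (Subtype.val '' (Z : Set F)) := hFc.isClosedMap_subtype_val _ Z.2.1.isClosed
  have h2 : IsClosed (Subtype.val '' (Z : Set F)ᶜ) :=
    hFc.isClosedMap_subtype_val _ Z.2.1.compl.isClosed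
  obtain ⟨n, hn⟩ := hKN
  obtain ⟨z, hzK, ⟨z1, hz1, rfl⟩, hz2⟩ := isPreconnected_closed_iff.1 hK.2 _
    (Subtype.val '' (Z : Set F)ᶜ ∪ (K ∩ N)) h1 (h2.union (hK.1.inter hN)) (by
      intro x hx
      by_cases hxN : x ∈ N
      · exact Or.inr (Or.inr ⟨hx, hxN⟩)
      · have hxF : x ∈ F := subset_closure ⟨hx, hxN⟩
        by_cases hxZ : (⟨x, hxF⟩ : F) ∈ (Z : Set F)
        · exact Or.inl ⟨_, hxZ, rfl⟩
        · exact Or.inr (Or.inl ⟨_, hxZ, rfl⟩)) ⟨q, hq, q', Z.2.2, rfl⟩ ⟨n, hn.1, Or.inr hn⟩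
  rcases hz2 with ⟨z2, hz2, h⟩ | h
  · rw [Subtype.val_injective h] at hz2; exact hz2 hz1
  · exact hZ hz1 h.2

theorem bump_small [CompactSpace Y] [T2Space Y] {K U : Set Y} (hK : Cnt K) (hnt : K.Nontrivial)
    (hU : IsOpen U) {q : Y} (hq : q ∈ K) (hqU : q ∈ U) :
    ∃ Q, Cnt Q ∧ q ∈ Q ∧ Q ⊆ K ∩ U ∧ Q.Nontrivial := by
  obtain ⟨W, hW, hWcl, hWo⟩ : ∃ W, q ∈ W ∧ closure W ⊆ U ∧ IsOpen W := by
    obtain ⟨W, hW, hc, hs⟩ := exists_mem_nhds_isClosed_subset (hU.mem_nhds hqU)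
    exact ⟨interior W, mem_interior_iff_mem_nhds.2 hW,
      (closure_minimal interior_subset hc).trans hs, isOpen_interior⟩
  by_cases hKW : K ⊆ W
  · exact ⟨K, hK, hq, fun x hx => ⟨hx, hWcl (subset_closure (hKW hx))⟩, hnt⟩
  · obtain ⟨y, hyK, hyW⟩ := not_subset.1 hKW
    obtain ⟨Q, hQ, hqQ, hs, z, hzQ, hzN⟩ := bump hK hWo.isClosed_compl hq (by simpa using hW) ⟨y, hyK, hyW⟩
    refine ⟨Q, hQ, hqQ, fun x hx => ⟨closure_minimal sdiff_subset hK.1 (hs hx), hWcl ?_⟩, ?_⟩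
    · refine closure_mono ?_ (hs hx)
      rintro a ⟨-, ha⟩; simpa using ha
    · exact ⟨q, hqQ, z, hzQ, by rintro rfl; exact hzN hW⟩

theorem irr_diff [CompactSpace Y] [T2Space Y] {K N : Set Y} {p q : Y} (h : Irr K p q)
    (hN : Cnt N) (hNK : N ⊆ K) (hp : p ∈ N) (hq : q ∉ N) : Cnt (closure (K \ N)) := by
  obtain ⟨Q, hQ, hqQ, hs, hne⟩ := bump h.1 hN.1 h.2.2.1 hq ⟨p, h.2.1, hp⟩
  have hFK : closure (K \ N) ⊆ K := closure_minimal sdiff_subset h.1.1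
  have := h.2.2.2 (N ∪ Q) (union_subset hNK (hs.trans hFK)) (hN.union hQ (by rwa [inter_comm]))
    (Or.inl hp) (Or.inr hqQ)
  have h2 : closure (K \ N) = Q := by
    apply subset_antisymm _ hs
    apply closure_minimal _ hQ.1
    rintro x ⟨hx, hxN⟩
    rw [← this] at hx
    exact hx.resolve_left hxN
  rwa [h2]

theorem irr_chain [CompactSpace Y] [T2Space Y] (hcr : CReg Y) {K A B : Set Y} {p q : Y}
    (h : Irr K p q) (hA : Cnt A) (hAK : A ⊆ K) (hpA : p ∈ A) (hB : Cnt B) (hBK : B ⊆ K)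
    (hpB : p ∈ B) : A ⊆ B ∨ B ⊆ A := by
  by_contra! hcon
  obtain ⟨h1, h2⟩ := hcon
  by_cases hqB : q ∈ B
  · exact h1 (hAK.trans (h.2.2.2 B hBK hB hpB hqB).ge)
  have hQ := irr_diff h hB hBK hpB hqB
  have hFK : closure (K \ B) ⊆ K := closure_minimal sdiff_subset h.1.1
  obtain ⟨a, haA, haB⟩ := not_subset.1 h1
  have hU := h.2.2.2 (A ∪ closure (K \ B)) (union_subset hAK hFK)
    (hA.union hQ ⟨a, haA, subset_closure ⟨hAK haA, haB⟩⟩) (Or.inl hpA)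
    (Or.inr (subset_closure ⟨h.2.2.1, hqB⟩))
  obtain ⟨z, hzB, hzA⟩ := not_subset.1 h2
  obtain ⟨M, hM, hzM, hMs, hMn⟩ := bump_small hB ⟨z, hzB, p, hpB, by rintro rfl; exact hzA hpA⟩
    hA.1.isOpen_compl hzB hzA
  obtain ⟨g, hg⟩ := hcr M hM hMn
  have hgM := interior_subset hg
  have hgK : g ∈ A ∪ closure (K \ B) := by rw [hU]; exact hBK (hMs hgM).1
  have hgc := hgK.resolve_left (hMs hgM).2
  obtain ⟨w, hw1, hw2⟩ := mem_closure_iff.1 hgc _ isOpen_interior hg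
  exact hw2.2 (hMs (interior_subset hw1)).1

theorem irr_unique [CompactSpace Y] [T2Space Y] (hcr : CReg Y) {K : Set Y} {p x y : Y}
    (hx : Irr K p x) (hy : Irr K p y) : x = y := by
  by_contra hne
  have hpx : p ≠ x := by
    rintro rfl
    have := hx.2.2.2 {p} (by simpa using hx.2.1) ⟨isClosed_singleton, isPreconnected_singleton⟩ rfl rfl
    have h2 := hy.2.2.1
    rw [← this] at h2
    exact hne h2.symm
  obtain ⟨N, hN, hxN, hNs, hNn⟩ := bump_small (U := {p, y}ᶜ) hx.1 ⟨p, hx.2.1, x, hx.2.2.1, hpx⟩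
    (Set.Finite.isClosed (by simp)).isOpen_compl hx.2.2.1 (by simp [hpx.symm, hne])
  have hpN : p ∉ N := fun h => (hNs h).2 (by simp)
  have hyN : y ∉ N := fun h => (hNs h).2 (by simp)
  have hQ := irr_diff hx.symm hN (fun z hz => (hNs hz).1) hxN hpN
  have := hy.2.2.2 _ (closure_minimal sdiff_subset hx.1.1) hQ (subset_closure ⟨hx.2.1, hpN⟩)
    (subset_closure ⟨hy.2.2.1, hyN⟩)
  obtain ⟨g, hg⟩ := hcr N hN hNn
  have hgK : g ∈ closure (K \ N) := by rw [this]; exact (hNs (interior_subset hg)).1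
  obtain ⟨w, hw1, hw2⟩ := mem_closure_iff.1 hgK _ isOpen_interior hg
  exact hw2.2 (interior_subset hw1)

theorem exists_irr [CompactSpace Y] [T2Space Y] {A : Set Y} (hA : Cnt A) {p q : Y} (hp : p ∈ A)
    (hq : q ∈ A) : ∃ K ⊆ A, Irr K p q := by
  obtain ⟨K, hKA, hK⟩ := zorn_superset_nonempty {B : Set Y | Cnt B ∧ p ∈ B ∧ q ∈ B} (by
    intro c hc hch hne
    refine ⟨⋂₀ c, ⟨cnt_sInter hne (fun B hB => (hc hB).1) (fun B hB C hC => hch.total hB hC),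
      fun B hB => (hc hB).2.1, fun B hB => (hc hB).2.2⟩, fun s hs => sInter_subset_of_mem hs⟩)
    A ⟨hA, hp, hq⟩
  refine ⟨K, hKA, hK.prop.1, hK.prop.2.1, hK.prop.2.2, fun B hB hBc h1 h2 => ?_⟩
  exact (hK.eq_of_superset ⟨hBc, h1, h2⟩ hB).symm

/-- Least continuum in `K` through `p` and `x`. -/
def hullC (K : Set Y) (p x : Y) : Set Y := ⋂₀ {A | A ⊆ K ∧ Cnt A ∧ p ∈ A ∧ x ∈ A}

theorem hullC_irr [CompactSpace Y] [T2Space Y] (hcr : CReg Y) {K : Set Y} {p q x : Y}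
    (h : Irr K p q) (hx : x ∈ K) : Irr (hullC K p x) p x := by
  refine ⟨cnt_sInter ⟨K, subset_rfl, h.1, h.2.1, hx⟩ (fun A hA => hA.2.1) (fun A hA B hB =>
    irr_chain hcr h hA.2.1 hA.1 hA.2.2.1 hB.2.1 hB.1 hB.2.2.1), fun A hA => hA.2.2.1,
    fun A hA => hA.2.2.2, fun A hA hc h1 h2 => ?_⟩
  have hK : hullC K p x ⊆ K := sInter_subset_of_mem ⟨subset_rfl, h.1, h.2.1, hx⟩
  exact hA.antisymm (sInter_subset_of_mem ⟨hA.trans hK, hc, h1, h2⟩)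

theorem hullC_subset {K : Set Y} {p q x : Y} (h : Irr K p q) (hx : x ∈ K) :
    hullC K p x ⊆ K := sInter_subset_of_mem ⟨subset_rfl, h.1, h.2.1, hx⟩

theorem hullC_mono [CompactSpace Y] [T2Space Y] (hcr : CReg Y) {K : Set Y} {p q x y : Y}
    (h : Irr K p q) (hx : x ∈ K) (hy : y ∈ hullC K p x) : hullC K p y ⊆ hullC K p x :=
  have h1 := hullC_irr hcr h hx
  sInter_subset_of_mem ⟨hullC_subset h hx, h1.1, h1.2.1, hy⟩

theorem hullC_antisymm [CompactSpace Y] [T2Space Y] (hcr : CReg Y) {K : Set Y} {p q x y : Y}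
    (h : Irr K p q) (hx : x ∈ K) (hy : y ∈ K) (h1 : y ∈ hullC K p x) (h2 : x ∈ hullC K p y) :
    x = y := by
  have he : hullC K p x = hullC K p y :=
    (hullC_mono hcr h hy h2).antisymm (hullC_mono hcr h hx h1)
  have h3 := hullC_irr hcr h hx
  rw [he] at h3
  exact irr_unique hcr h3 (hullC_irr hcr h hy)

theorem hullC_total [CompactSpace Y] [T2Space Y] (hcr : CReg Y) {K : Set Y} {p q x y : Y}
    (h : Irr K p q) (hx : x ∈ K) (hy : y ∈ K) : y ∈ hullC K p x ∨ x ∈ hullC K p y := by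
  have h1 := hullC_irr hcr h hx
  have h2 := hullC_irr hcr h hy
  rcases irr_chain hcr h h1.1 (hullC_subset h hx) h1.2.1 h2.1 (hullC_subset h hy) h2.2.1 with h3 | h3
  · exact Or.inr (h3 h1.2.2.1)
  · exact Or.inl (h3 h2.2.2.1)

theorem hullC_union [CompactSpace Y] [T2Space Y] (hcr : CReg Y) {K : Set Y} {p q x : Y}
    (h : Irr K p q) (hx : x ∈ K) : hullC K p x ∪ hullC K q x = K := by
  have h1 := hullC_irr hcr h hx
  have h2 := hullC_irr hcr h.symm hx
  exact h.2.2.2 _ (union_subset (hullC_subset h hx) (hullC_subset h.symm hx))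
    (h1.1.union h2.1 ⟨x, h1.2.2.1, h2.2.2.1⟩) (Or.inl h1.2.1) (Or.inr h2.2.1)

theorem hullC_inter [CompactSpace Y] [T2Space Y] (hcr : CReg Y) {K : Set Y} {p q x y : Y}
    (h : Irr K p q) (hx : x ∈ K) (h1 : y ∈ hullC K p x) (h2 : y ∈ hullC K q x) : y = x := by
  by_contra hne
  have hy : y ∈ K := hullC_subset h hx h1
  have : x ∈ hullC K p y ∪ hullC K q y := by rwa [hullC_union hcr h hy]
  rcases this with h3 | h3
  · exact hne (hullC_antisymm hcr h hy hx h3 h1)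
  · exact hne (hullC_antisymm hcr h.symm hy hx h3 h2)

/-- `x ∈ hull p y ↔ y ∈ hull q x`. -/
theorem hullC_flip [CompactSpace Y] [T2Space Y] (hcr : CReg Y) {K : Set Y} {p q x y : Y}
    (h : Irr K p q) (hx : x ∈ K) (hy : y ∈ K) : x ∈ hullC K p y ↔ y ∈ hullC K q x := by
  constructor
  · intro h1
    have : y ∈ hullC K p x ∪ hullC K q x := by rwa [hullC_union hcr h hx]
    rcases this with h2 | h2
    · have := hullC_antisymm hcr h hx hy h2 h1
      subst this
      exact (hullC_irr hcr h.symm hx).2.2.1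
    · exact h2
  · intro h1
    have : x ∈ hullC K p y ∪ hullC K q y := by rwa [hullC_union hcr h hy]
    rcases this with h2 | h2
    · exact h2
    · have := hullC_antisymm hcr h.symm hx hy h1 h2
      subst this
      exact (hullC_irr hcr h hx).2.2.1


theorem order_embeds {L : Type u} [TopologicalSpace L] [CompactSpace L] [ConnectedSpace L]
    [SecondCountableTopology L] [LinearOrder L] [Nontrivial L]
    (h1 : ∀ a : L, IsClosed (Iic a)) (h2 : ∀ a : L, IsClosed (Ici a)) :
    ∃ f : L → ℝ, Continuous f ∧ Injective f := by
  haveI : OrderTopology L := by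
    have hT : ∀ t' : TopologicalSpace L, @OrderTopology L t' _ → @T2Space L t' := fun t' _ =>
      inferInstance
    have hle : ‹TopologicalSpace L› ≤ Preorder.topology L := by
      apply le_generateFrom
      rintro s ⟨a, rfl | rfl⟩
      · have := (h1 a).isOpen_compl
        rwa [compl_Iic] at this
      · have := (h2 a).isOpen_compl
        rwa [compl_Ici] at this
    have hT2 : @T2Space L (Preorder.topology L) := hT _ (@OrderTopology.mk L (Preorder.topology L) _ rfl)
    have hc : @Continuous L L _ (Preorder.topology L) id := continuous_id_iff_le.2 hle
    have hcl : @IsClosedMap L L _ (Preorder.topology L) id :=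
      @Continuous.isClosedMap L L _ (Preorder.topology L) _ hT2 id hc
    refine ⟨le_antisymm hle ?_⟩
    rw [TopologicalSpace.le_def]
    intro s hs
    have := hcl sᶜ hs.isClosed_compl
    rw [image_id] at this
    exact (@isClosed_compl_iff L (Preorder.topology L) s).1 this
  haveI : DenselyOrdered L := denselyOrdered_of_preconnectedSpace
  obtain ⟨D, hDc, hDd, hbot, htop⟩ := exists_countable_dense_no_bot_top L
  have hbtw : ∀ a b : L, a < b → ∃ d ∈ D, a < d ∧ d < b := fun a b hab => by
    obtain ⟨d, hd, hd'⟩ := hDd.exists_between hab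
    exact ⟨d, hd, hd'⟩
  have hlow : ∀ d ∈ D, ∃ a, a < d := fun d hd => by
    by_contra! hcon
    exact hbot d hcon hd
  have hup : ∀ d ∈ D, ∃ a, d < a := fun d hd => by
    by_contra! hcon
    exact htop d hcon hd
  haveI : Countable D := hDc
  haveI : DenselyOrdered D := ⟨fun a b hab => by
    obtain ⟨d, hd, h⟩ := hbtw a b hab; exact ⟨⟨d, hd⟩, h⟩⟩
  haveI : NoMinOrder D := ⟨fun a => by
    obtain ⟨b, hb⟩ := hlow a a.2
    obtain ⟨d, hd, h⟩ := hbtw _ _ hb; exact ⟨⟨d, hd⟩, h.2⟩⟩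
  haveI : NoMaxOrder D := ⟨fun a => by
    obtain ⟨b, hb⟩ := hup a a.2
    obtain ⟨d, hd, h⟩ := hbtw _ _ hb; exact ⟨⟨d, hd⟩, h.1⟩⟩
  haveI : Nonempty D := hDd.nonempty.to_subtype
  obtain ⟨φ⟩ := Order.iso_of_countable_dense D ℚ
  let c : D → EReal := fun d => (((φ d : ℚ) : ℝ) : EReal)
  have hc : StrictMono c := fun a b hab => by
    have : φ a < φ b := φ.strictMono hab
    simpa [c] using this
  let g : L → EReal := fun x => ⨆ d : {d : D // (d : L) ≤ x}, c d
  have hgm : Monotone g := fun x y hxy => iSup_le fun d =>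
    le_iSup (fun d : {d : D // (d : L) ≤ y} => c d) ⟨d.1, d.2.trans hxy⟩
  have hgd : ∀ d : D, g d = c d := fun d => by
    apply le_antisymm
    · exact iSup_le fun e => hc.monotone e.2
    · exact le_iSup (fun e : {e : D // (e : L) ≤ d} => c e) ⟨d, le_rfl⟩
  have hgs : StrictMono g := fun x y hxy => by
    obtain ⟨d, hd, hd1, hd2⟩ := hbtw x y hxy
    obtain ⟨e, he, he1, he2⟩ := hbtw d y hd2
    calc g x ≤ g d := hgm hd1.le
      _ = c ⟨d, hd⟩ := hgd ⟨d, hd⟩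
      _ < c ⟨e, he⟩ := hc he1
      _ = g e := (hgd ⟨e, he⟩).symm
      _ ≤ g y := hgm he2.le
  have hdr : DenseRange g := by
    apply dense_of_exists_between
    intro a b hab
    obtain ⟨r, hr1, hr2⟩ := EReal.lt_iff_exists_rat_btwn.1 hab
    refine ⟨_, ⟨(φ.symm r : D), rfl⟩, ?_⟩
    rw [hgd]
    simp only [c, OrderIso.apply_symm_apply]
    exact ⟨hr1, hr2⟩
  have hgc : Continuous g := hgm.continuous_of_denseRange hdr
  let e := EReal.expHomeomorph.trans ENNReal.orderIsoUnitIntervalBirational.toHomeomorph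
  exact ⟨fun x => (e (g x) : ℝ), continuous_subtype_val.comp (e.continuous.comp hgc),
    Subtype.val_injective.comp (e.injective.comp hgs.injective)⟩

theorem irr_embeds [CompactSpace Y] [T2Space Y] [SecondCountableTopology Y] (hcr : CReg Y)
    {K : Set Y} {p q : Y} (h : Irr K p q) (hpq : p ≠ q) :
    ∃ f : K → ℝ, Continuous f ∧ Injective f := by
  classical
  letI : LinearOrder K :=
    { le := fun x y => (x : Y) ∈ hullC K p y
      le_refl := fun x => (hullC_irr hcr h x.2).2.2.1
      le_trans := fun x y z hxy hyz => hullC_mono hcr h z.2 hyz hxy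
      le_antisymm := fun x y hxy hyx => Subtype.ext (hullC_antisymm hcr h x.2 y.2 hyx hxy)
      le_total := fun x y => (hullC_total hcr h x.2 y.2).symm
      toDecidableLE := Classical.decRel _ }
  haveI : CompactSpace K := isCompact_iff_compactSpace.1 h.1.1.isCompact
  haveI : ConnectedSpace K := isConnected_iff_connectedSpace.1 ⟨⟨p, h.2.1⟩, h.1.2⟩
  haveI : Nontrivial K := ⟨⟨p, h.2.1⟩, ⟨q, h.2.2.1⟩, by simpa using hpq⟩
  apply order_embeds
  · intro a
    exact (hullC_irr hcr h a.2).1.1.preimage continuous_subtype_val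
  · intro a
    have := (hullC_irr hcr h.symm a.2).1.1.preimage (continuous_subtype_val (p := (· ∈ K)))
    convert this using 1
    ext x
    exact hullC_flip hcr h a.2 x.2

theorem exists_arc_of_embeds [CompactSpace Y] [T2Space Y] (hcr : CReg Y) {K : Set Y} (hK : Cnt K)
    (hnt : K.Nontrivial) {f : K → ℝ} (hf : Continuous f) (hi : Injective f) :
    ∃ g : Ioo (0 : ℝ) 1 → Y, IsOpenEmbedding g ∧ range g ⊆ K := by
  haveI : CompactSpace K := isCompact_iff_compactSpace.1 hK.1.isCompact
  haveI : PreconnectedSpace K := isPreconnected_iff_preconnectedSpace.1 hK.2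
  have hemb : IsClosedEmbedding f := hf.isClosedEmbedding hi
  have hoc : (range f).OrdConnected := (isPreconnected_range hf).ordConnected
  obtain ⟨x, hx⟩ := hcr K hK hnt
  have hxK := interior_subset hx
  obtain ⟨O, hO, hOG⟩ := hemb.isInducing.isOpen_iff.1
    (isOpen_interior.preimage (continuous_subtype_val (p := (· ∈ K))) : IsOpen (Subtype.val ⁻¹' (interior K) : Set K))
  have hyO : f ⟨x, hxK⟩ ∈ O := by
    have : (⟨x, hxK⟩ : K) ∈ f ⁻¹' O := by rw [hOG]; exact hx
    exact this
  obtain ⟨ε, hε, hball⟩ := Metric.isOpen_iff.1 hO _ hyO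
  obtain ⟨z, hzK, hzx⟩ := hnt.exists_ne x
  obtain ⟨c, d, hcd, hsub⟩ : ∃ c d : ℝ, c < d ∧ Ioo c d ⊆ range f ∩ O := by
    have hne : f ⟨z, hzK⟩ ≠ f ⟨x, hxK⟩ := fun h => hzx (congrArg Subtype.val (hi h))
    rw [Real.ball_eq_Ioo] at hball
    rcases lt_or_gt_of_ne hne with h | h
    · refine ⟨max (f ⟨z, hzK⟩) (f ⟨x, hxK⟩ - ε), f ⟨x, hxK⟩, max_lt h (by linarith), ?_⟩
      rintro t ⟨ht1, ht2⟩
      rw [max_lt_iff] at ht1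
      exact ⟨hoc.out ⟨_, rfl⟩ ⟨_, rfl⟩ ⟨ht1.1.le, ht2.le⟩, hball ⟨ht1.2, by linarith⟩⟩
    · refine ⟨f ⟨x, hxK⟩, min (f ⟨z, hzK⟩) (f ⟨x, hxK⟩ + ε), lt_min h (by linarith), ?_⟩
      rintro t ⟨ht1, ht2⟩
      rw [lt_min_iff] at ht2
      exact ⟨hoc.out ⟨_, rfl⟩ ⟨_, rfl⟩ ⟨ht1.le, ht2.1.le⟩, hball ⟨by linarith, ht2.2⟩⟩
  let a : Ioo (0 : ℝ) 1 → ℝ := fun t => c + (d - c) * t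
  have hdc : 0 < d - c := by linarith
  have ha : ∀ t, a t ∈ Ioo c d := fun t => by
    have h1 := mul_pos hdc t.2.1
    have h2 := mul_lt_mul_of_pos_left t.2.2 hdc
    exact ⟨by simp only [a]; linarith, by simp only [a]; linarith⟩
  let hm : ℝ ≃ₜ ℝ := (Homeomorph.mulLeft₀ (d - c) hdc.ne').trans (Homeomorph.addLeft c)
  have hae : IsEmbedding a := hm.isEmbedding.comp IsEmbedding.subtypeVal
  let b : Ioo (0 : ℝ) 1 → range f := fun t => ⟨a t, (hsub (ha t)).1⟩
  have hbe : IsEmbedding b := hae.codRestrict _ _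
  let F : K ≃ₜ range f := hemb.isEmbedding.toHomeomorph
  let g : Ioo (0 : ℝ) 1 → Y := fun t => (F.symm (b t) : Y)
  have hge : IsEmbedding g := IsEmbedding.subtypeVal.comp (F.symm.isEmbedding.comp hbe)
  have hfF : ∀ t, f (F.symm (b t)) = a t := fun t =>
    congrArg Subtype.val (F.apply_symm_apply (b t))
  refine ⟨g, ⟨hge, ?_⟩, ?_⟩
  · obtain ⟨W, hW, hWe⟩ := isOpen_induced_iff.1 (isOpen_Ioo.preimage hf : IsOpen (f ⁻¹' Ioo c d))
    have : range g = W ∩ interior K := by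
      ext y
      constructor
      · rintro ⟨t, rfl⟩
        constructor
        · have : F.symm (b t) ∈ Subtype.val ⁻¹' W := by
            rw [hWe, mem_preimage, hfF]; exact ha t
          exact this
        · have : F.symm (b t) ∈ Subtype.val ⁻¹' (interior K) := by
            rw [← hOG, mem_preimage, hfF]; exact (hsub (ha t)).2
          exact this
      · rintro ⟨hyW, hyi⟩
        have hyK := interior_subset hyi
        have h3 : f ⟨y, hyK⟩ ∈ Ioo c d := by
          have : (⟨y, hyK⟩ : K) ∈ f ⁻¹' Ioo c d := by rw [← hWe]; exact hyW
          exact this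
        refine ⟨⟨(f ⟨y, hyK⟩ - c) / (d - c), div_pos (by linarith [h3.1]) hdc,
          (div_lt_one hdc).2 (by linarith [h3.2])⟩, ?_⟩
        have : F.symm (b ⟨(f ⟨y, hyK⟩ - c) / (d - c), div_pos (by linarith [h3.1]) hdc,
          (div_lt_one hdc).2 (by linarith [h3.2])⟩) = ⟨y, hyK⟩ := by
          apply hi
          rw [hfF]
          simp only [a]
          field_simp
          ring
        exact congrArg Subtype.val this
    rw [this]
    exact hW.inter isOpen_interior
  · rintro _ ⟨t, rfl⟩
    exact (F.symm (b t)).2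

theorem exists_arc [CompactSpace Y] [T2Space Y] [SecondCountableTopology Y] (hcr : CReg Y)
    {A : Set Y} (hA : Cnt A) (hnt : A.Nontrivial) :
    ∃ g : Ioo (0 : ℝ) 1 → Y, IsOpenEmbedding g ∧ range g ⊆ A := by
  obtain ⟨p, hp, q, hq, hpq⟩ := hnt
  obtain ⟨K, hKA, hK⟩ := exists_irr hA hp hq
  obtain ⟨f, hf, hi⟩ := irr_embeds hcr hK hpq
  obtain ⟨g, hg, hr⟩ := exists_arc_of_embeds hcr hK.1 ⟨p, hK.2.1, q, hK.2.2.1, hpq⟩ hf hi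
  exact ⟨g, hg, hr.trans hKA⟩

theorem graphLike_of_creg [CompactSpace Y] [T2Space Y] [SecondCountableTopology Y]
    (hcr : CReg Y) : Nonempty (GraphLike Y) := by
  let P : Set (Set (Set Y)) := {S | (∀ U ∈ S, ∃ g : Ioo (0 : ℝ) 1 → Y, IsOpenEmbedding g ∧
    range g = U) ∧ S.PairwiseDisjoint id}
  obtain ⟨S, hS⟩ : ∃ S, Maximal (· ∈ P) S := by
    apply zorn_subset
    intro c hc hch
    refine ⟨⋃₀ c, ⟨?_, ?_⟩, fun s hs => subset_sUnion_of_mem hs⟩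
    · rintro U ⟨s, hs, hU⟩
      exact (hc hs).1 U hU
    · exact (Set.pairwiseDisjoint_sUnion hch.directedOn).2 fun s hs => (hc hs).2
  have hopen : ∀ U ∈ S, IsOpen U := fun U hU => by
    obtain ⟨g, hg, rfl⟩ := hS.prop.1 U hU
    exact hg.isOpen_range
  have hne : ∀ U ∈ S, U.Nonempty := fun U hU => by
    obtain ⟨g, hg, rfl⟩ := hS.prop.1 U hU
    exact ⟨_, ⟨1/2, by norm_num, by norm_num⟩, rfl⟩
  have hcount : S.Countable := hS.prop.2.countable_of_isOpen hopen hne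
  obtain ⟨ι, hι⟩ := hcount.exists_injective_nat
  let E : Type := range ι
  let eqv : S ≃ E := Equiv.ofInjective ι hι
  have hex : ∀ e : E, ∃ g : Ioo (0 : ℝ) 1 → Y, IsOpenEmbedding g ∧ range g = (eqv.symm e : Set Y) :=
    fun e => hS.prop.1 _ (eqv.symm e).2
  choose g hg hr using hex
  letI : TopologicalSpace E := ⊥
  haveI : DiscreteTopology E := ⟨rfl⟩
  let G : E × Ioo (0 : ℝ) 1 → Y := fun x => g x.1 x.2
  have hGc : Continuous G := by
    rw [continuous_prod_of_discrete_left]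
    exact fun e => (hg e).continuous
  have hGi : Injective G := by
    rintro ⟨e, t⟩ ⟨e', t'⟩ h
    have hee : e = e' := by
      by_contra hne
      have h1 : (eqv.symm e : Set Y) ≠ eqv.symm e' := fun h =>
        hne (eqv.symm.injective (Subtype.ext h))
      have h2 := hS.prop.2 (eqv.symm e).2 (eqv.symm e').2 h1
      have h3 : g e t ∈ (eqv.symm e : Set Y) := by rw [← hr]; exact ⟨t, rfl⟩
      have h4 : g e t ∈ (eqv.symm e' : Set Y) := by
        rw [← hr]; exact ⟨t', h.symm⟩
      exact Set.disjoint_left.1 h2 h3 h4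
    subst hee
    exact congrArg (Prod.mk e) ((hg e).injective h)
  have hGo : IsOpenMap G := by
    intro U hU
    have : G '' U = ⋃ e, g e '' (Prod.mk e ⁻¹' U) := by
      ext y; simp [G]
    rw [this]
    exact isOpen_iUnion fun e => (hg e).isOpenMap _ (hU.preimage (Continuous.prodMk_right e))
  have hGe : IsOpenEmbedding G := .of_continuous_injective_isOpenMap hGc hGi hGo
  have hrS : range G = ⋃₀ S := by
    ext y
    constructor
    · rintro ⟨⟨e, t⟩, rfl⟩
      refine ⟨_, (eqv.symm e).2, ?_⟩
      rw [← hr]; exact ⟨t, rfl⟩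
    · rintro ⟨U, hU, hy⟩
      have : y ∈ range (g (eqv ⟨U, hU⟩)) := by rw [hr]; simpa using hy
      obtain ⟨t, rfl⟩ := this
      exact ⟨(_, t), rfl⟩
  have hV : IsClosed (range G)ᶜ := hGe.isOpen_range.isClosed_compl
  refine ⟨⟨(range G)ᶜ, hV, ?_, E, ?_⟩⟩
  · refine totallyDisconnectedSpace_subtype_iff.2 ?_
    intro A hAV hA
    by_contra hnt
    rw [not_subsingleton_iff] at hnt
    have hcA : Cnt (closure A) := ⟨isClosed_closure, hA.closure⟩
    obtain ⟨k, hk, hkA⟩ := exists_arc hcr hcA (hnt.mono subset_closure)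
    have hkV : range k ⊆ (range G)ᶜ := hkA.trans (closure_minimal hAV hV)
    have hkd : ∀ U ∈ S, Disjoint (range k) U := fun U hU => by
      rw [Set.disjoint_left]
      intro y hy hyU
      exact hkV hy (hrS ▸ ⟨U, hU, hyU⟩)
    have hins : insert (range k) S ∈ P := by
      refine ⟨?_, ?_⟩
      · rintro U (rfl | hU)
        · exact ⟨k, hk, rfl⟩
        · exact hS.prop.1 U hU
      · exact hS.prop.2.insert fun U hU _ => hkd U hU
    have hmem : range k ∈ S := hS.le_of_ge hins (subset_insert _ _) (mem_insert _ _)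
    have := hkd _ hmem
    rw [disjoint_self] at this
    exact (hne _ hmem).ne_empty this
  · exact ⟨((Homeomorph.setCongr (compl_compl (range G))).trans hGe.isEmbedding.toHomeomorph.symm)⟩

theorem creg_of_graphLike [CompactSpace Y] [T2Space Y] (G : GraphLike Y) {A : Set Y}
    (hA : IsPreconnected A) (hnt : A.Nontrivial) : (interior A).Nonempty := by
  letI : TopologicalSpace G.E := ⊥
  haveI : DiscreteTopology G.E := ⟨rfl⟩
  obtain ⟨φ⟩ : Nonempty ((G.Vᶜ : Set Y) ≃ₜ (G.E × ↥(Set.Ioo (0 : ℝ) 1))) := G.homeo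
  have htd : IsTotallyDisconnected G.V := totallyDisconnectedSpace_subtype_iff.1 G.zeroDimV
  have hAV : ¬ A ⊆ G.V := fun h => by
    rw [← not_subsingleton_iff] at hnt
    exact hnt (htd A h hA)
  obtain ⟨x, hxA, hxV⟩ := not_subset.1 hAV
  obtain ⟨y, hyA, hyx⟩ := hnt.exists_ne x
  by_contra hint
  rw [not_nonempty_iff_eq_empty] at hint
  let e := (φ ⟨x, hxV⟩).1
  let t := (φ ⟨x, hxV⟩).2
  let g : Ioo (0 : ℝ) 1 → Y := fun s => (φ.symm (e, s) : Y)
  have hgo : IsOpenEmbedding g := by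
    refine (G.closedV.isOpen_compl.isOpenEmbedding_subtypeVal).comp
      (φ.symm.isOpenEmbedding.comp ?_)
    refine .of_continuous_injective_isOpenMap (Continuous.prodMk_right e)
      (Prod.mk_right_injective e) (fun U hU => by rw [← singleton_prod]; exact (isOpen_discrete _).prod hU)
  have hgt : g t = x := by
    have : φ.symm (e, t) = ⟨x, hxV⟩ := φ.symm_apply_apply _
    exact congrArg Subtype.val this
  have hnear : ∀ s : Set (Ioo (0 : ℝ) 1), IsOpen s → s.Nonempty → ∃ r ∈ s, g r ∉ A := by
    intro s hs hne
    by_contra! hcon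
    have : g '' s ⊆ interior A := interior_maximal (by rintro _ ⟨r, hr, rfl⟩; exact hcon r hr)
      (hgo.isOpenMap s hs)
    rw [hint, subset_empty_iff, image_eq_empty] at this
    exact hne.ne_empty this
  have hO : IsOpen (g ⁻¹' {y}ᶜ) := isOpen_compl_singleton.preimage hgo.continuous
  have htO : t ∈ g ⁻¹' {y}ᶜ := by
    change g t ≠ y
    rw [hgt]; exact hyx.symm
  obtain ⟨l, u, ⟨hl, hu⟩, hlu⟩ := (mem_nhds_iff_exists_Ioo_subset' (exists_lt t) (exists_gt t)).1
    (hO.mem_nhds htO)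
  obtain ⟨a, ha, haA⟩ := hnear (Ioo l t) isOpen_Ioo (nonempty_Ioo.2 hl)
  obtain ⟨b, hb, hbA⟩ := hnear (Ioo t u) isOpen_Ioo (nonempty_Ioo.2 hu)
  have hab : a < b := ha.2.trans hb.1
  have h1 : IsOpen (g '' Ioo a b) := hgo.isOpenMap _ isOpen_Ioo
  have h2 : IsClosed (g '' Icc a b) := by
    have hci : IsCompact (Icc a b) := by
      rw [IsEmbedding.subtypeVal.isCompact_iff]
      have : Subtype.val '' Icc a b = Icc (a : ℝ) b := by
        ext r
        constructor
        · rintro ⟨r, hr, rfl⟩; exact hr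
        · intro hr
          exact ⟨⟨r, a.2.1.trans_le hr.1, hr.2.trans_lt b.2.2⟩, hr, rfl⟩
      rw [this]; exact isCompact_Icc
    exact (hci.image hgo.continuous).isClosed
  obtain ⟨z, hzA, hz1, hz2⟩ := hA (g '' Ioo a b) (g '' Icc a b)ᶜ h1 h2.isOpen_compl (by
    intro z hz
    by_cases hzc : z ∈ g '' Icc a b
    · left
      obtain ⟨r, hr, rfl⟩ := hzc
      refine ⟨r, ⟨lt_of_le_of_ne hr.1 ?_, lt_of_le_of_ne hr.2 ?_⟩, rfl⟩
      · rintro rfl; exact haA hz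
      · rintro rfl; exact hbA hz
    · exact Or.inr hzc) ⟨x, hxA, t, ⟨ha.2, hb.1⟩, hgt⟩ ⟨y, hyA, by
      rintro ⟨r, hr, hry⟩
      exact hlu ⟨ha.1.trans_le hr.1, hr.2.trans_lt hb.2⟩ hry⟩
  exact hz2 (image_mono Ioo_subset_Icc_self hz1)

end helpers

/-- A continuum is completely regular (every nondegenerate
subcontinuum has nonempty interior) iff it is graph-like. -/
theorem completelyRegular_iff_graphLike
    [CompactSpace X] [TopologicalSpace.MetrizableSpace X] [ConnectedSpace X] :
    (∀ A : Set X, IsCompact A → IsConnected A → A.Nontrivial → (interior A).Nonempty) ↔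
    Nonempty (GraphLike X) := by
  constructor
  · intro h
    letI := TopologicalSpace.metrizableSpaceMetric X
    exact graphLike_of_creg fun A hA hnt => h A hA.1.isCompact ⟨hnt.nonempty, hA.2⟩ hnt
  · rintro ⟨G⟩ A - hA hnt
    exact creg_of_graphLike G hA.2 hnt
end

section
/- Let X be a graph-like continuum not homeomorphic to the circle S¹. Call a closed subset V ⊆ X a witness if V is zero-dimensional and X ∖ V is homeomorphic to E × (0,1) for some index set E with the discrete topology. Then the intersection of all witnesses is itself a witness; in particular there is a unique minimal set V ⊆ X witnessing that X is graph-like. -/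
open Set Topology Filter Function

universe u

variable {X : Type u} [TopologicalSpace X]

/-- A closed set `V ⊆ X` witnesses that `X` is graph-like if it is zero-dimensional and
`X ∖ V` is homeomorphic to `E × (0,1)` for some discrete index set `E`. -/
def IsWitness (X : Type u) [TopologicalSpace X] (V : Set X) : Prop :=
  IsClosed V ∧ TotallyDisconnectedSpace V ∧
    ∃ E : Type,
      letI : TopologicalSpace E := ⊥
      Nonempty ((Vᶜ : Set X) ≃ₜ (E × ↥(Set.Ioo (0 : ℝ) 1)))

namespace MinWit

/-- every point has an open neighbourhood homeomorphic to the line -/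
def Loc (M : Type*) [TopologicalSpace M] : Prop :=
  ∀ x : M, ∃ ψ : ℝ → M, IsOpenEmbedding ψ ∧ x ∈ range ψ

lemma exists_inv {M : Type*} [TopologicalSpace M] {ψ : ℝ → M} (hψ : IsOpenEmbedding ψ) :
    ∃ γ : M → ℝ, (∀ t, γ (ψ t) = t) ∧ (∀ y ∈ range ψ, ψ (γ y) = y) ∧
      ContinuousOn γ (range ψ) := by
  have hl : ∀ t, Function.invFun ψ (ψ t) = t := Function.leftInverse_invFun hψ.injective
  refine ⟨Function.invFun ψ, hl, ?_, ?_⟩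
  · rintro _ ⟨t, rfl⟩
    rw [hl]
  · rintro _ ⟨t, rfl⟩
    apply ContinuousAt.continuousWithinAt
    rw [← hψ.continuousAt_iff]
    have : Function.invFun ψ ∘ ψ = id := funext hl
    rw [this]
    exact continuousAt_id

lemma nhds_le {M : Type*} [TopologicalSpace M] (hM : Loc M) {c : ℝ → M} (hc : Continuous c)
    {a r : ℝ} (hr : 0 < r) (hinj : InjOn c (Ioo (a - r) (a + r))) :
    𝓝 (c a) ≤ map c (𝓝 a) := by
  obtain ⟨ψ, hψ, hx⟩ := hM (c a)
  obtain ⟨γ, h1, h2, h3⟩ := exists_inv hψ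
  intro S hS
  rw [mem_map] at hS
  have hW : c ⁻¹' (range ψ) ∈ 𝓝 a := (hψ.isOpen_range.preimage hc).mem_nhds hx
  obtain ⟨ε, hε, hball⟩ := Metric.mem_nhds_iff.1 (Filter.inter_mem hS hW)
  set s := min (ε / 2) (r / 2) with hs
  have hs0 : 0 < s := by positivity
  have hsε : s < ε := lt_of_le_of_lt (min_le_left _ _) (by linarith)
  have hsr : s < r := lt_of_le_of_lt (min_le_right _ _) (by linarith)
  have hsub : ∀ t ∈ Icc (a - s) (a + s), c t ∈ S ∧ c t ∈ range ψ := by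
    intro t ht
    have : t ∈ Metric.ball a ε := by
      rw [Metric.mem_ball, Real.dist_eq, abs_lt]
      constructor <;> linarith [ht.1, ht.2]
    exact hball this
  have hcont : ContinuousOn (fun t => γ (c t)) (Icc (a - s) (a + s)) :=
    h3.comp hc.continuousOn (fun t ht => (hsub t ht).2)
  have hI : InjOn (fun t => γ (c t)) (Icc (a - s) (a + s)) := by
    intro t ht t' ht' h
    have h' : γ (c t) = γ (c t') := h
    apply hinj ⟨by linarith [ht.1], by linarith [ht.2]⟩ ⟨by linarith [ht'.1], by linarith [ht'.2]⟩
    rw [← h2 _ (hsub t ht).2, ← h2 _ (hsub t' ht').2, h']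
  have key : (fun t => γ (c t)) '' (Icc (a - s) (a + s)) ∈ 𝓝 (γ (c a)) := by
    have ma : a ∈ Icc (a - s) (a + s) := ⟨by linarith, by linarith⟩
    have ml : a - s ∈ Icc (a - s) (a + s) := ⟨by linarith, by linarith⟩
    have mr : a + s ∈ Icc (a - s) (a + s) := ⟨by linarith, by linarith⟩
    rcases hcont.strictMonoOn_of_injOn_Icc' (by linarith) hI with hm | hm
    · refine Filter.mem_of_superset ?_ (intermediate_value_Icc (by linarith) hcont)
      exact Icc_mem_nhds (hm ml ma (by linarith)) (hm ma mr (by linarith))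
    · refine Filter.mem_of_superset ?_ (intermediate_value_Icc' (by linarith) hcont)
      exact Icc_mem_nhds (hm ma mr (by linarith)) (hm ml ma (by linarith))
  have h4 : ψ '' ((fun t => γ (c t)) '' (Icc (a - s) (a + s))) ∈ 𝓝 (ψ (γ (c a))) :=
    hψ.isOpenMap.image_mem_nhds key
  rw [h2 _ hx] at h4
  refine Filter.mem_of_superset h4 ?_
  rintro _ ⟨_, ⟨t, ht, rfl⟩, rfl⟩
  show ψ (γ (c t)) ∈ S
  rw [h2 _ (hsub t ht).2]
  exact (hsub t ht).1

lemma openEmb {M : Type*} [TopologicalSpace M] (hM : Loc M) {c : ℝ → M} (hc : Continuous c)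
    (hinj : Injective c) : IsOpenEmbedding c :=
  IsOpenEmbedding.of_continuous_injective_isOpenMap hc hinj
    (isOpenMap_iff_nhds_le.2 fun a => nhds_le hM hc (r := 1) one_pos hinj.injOn)

lemma circle_of {M : Type*} [TopologicalSpace M] [T2Space M] [ConnectedSpace M] (hM : Loc M)
    {f : ℝ → M} (hf : Continuous f) {δ : ℝ} (hδ : 0 < δ)
    (hgap : ∀ p q, p < q → f p = f q → δ ≤ q - p)
    {p₀ q₀ : ℝ} (h0 : p₀ < q₀) (h0' : f p₀ = f q₀) : Nonempty (M ≃ₜ Circle) := by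
  let S : Set (ℝ × ℝ) := (Icc p₀ q₀ ×ˢ Icc p₀ q₀) ∩ {z | f z.1 = f z.2 ∧ δ ≤ z.2 - z.1}
  have hS : IsCompact S := by
    apply (isCompact_Icc.prod isCompact_Icc).inter_right
    have e1 : IsClosed {z : ℝ × ℝ | f z.1 = f z.2} := isClosed_eq (by fun_prop) (by fun_prop)
    have e2 : IsClosed {z : ℝ × ℝ | δ ≤ z.2 - z.1} := isClosed_le (by fun_prop) (by fun_prop)
    exact e1.inter e2
  have hne : S.Nonempty :=
    ⟨(p₀, q₀), ⟨⟨le_rfl, h0.le⟩, ⟨h0.le, le_rfl⟩⟩, h0', hgap _ _ h0 h0'⟩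
  obtain ⟨⟨p, q⟩, ⟨⟨hp, hq⟩, hpq, hd⟩, hmin⟩ :=
    hS.exists_isMinOn hne (f := fun z : ℝ × ℝ => z.2 - z.1) (by fun_prop)
  simp only at hp hq hpq hd
  have hT : 0 < q - p := by linarith
  have : Fact (0 < q - p) := ⟨hT⟩
  have hinj : ∀ s t, p ≤ s → s < t → t < q → f s ≠ f t := by
    intro s t h1 h2 h3 h4
    have hm : (s, t) ∈ S := ⟨⟨⟨by linarith [hp.1], by linarith [hq.2]⟩,
      ⟨by linarith [hp.1], by linarith [hq.2]⟩⟩, h4, hgap _ _ h2 h4⟩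
    have := hmin hm
    simp only [mem_ofPred_eq] at this
    linarith
  let F : AddCircle (q - p) → M := AddCircle.liftIco (q - p) p f
  have hFc : Continuous F := by
    apply AddCircle.liftIco_continuous
    · rw [hpq]; congr 1; ring
    · exact hf.continuousOn
  have hFinj : Injective F := by
    intro x y hxy
    obtain ⟨s, hs, rfl⟩ : ∃ s ∈ Ico p (p + (q - p)), (s : AddCircle (q - p)) = x :=
      ⟨_, (AddCircle.equivIco (q - p) p x).2, AddCircle.coe_equivIco⟩
    obtain ⟨t, ht, rfl⟩ : ∃ s ∈ Ico p (p + (q - p)), (s : AddCircle (q - p)) = y :=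
      ⟨_, (AddCircle.equivIco (q - p) p y).2, AddCircle.coe_equivIco⟩
    simp only [F, AddCircle.liftIco_coe_apply hs, AddCircle.liftIco_coe_apply ht] at hxy
    rcases lt_trichotomy s t with h | h | h
    · exact absurd hxy (hinj s t hs.1 h (by linarith [ht.2]))
    · rw [h]
    · exact absurd hxy.symm (hinj t s ht.1 h (by linarith [hs.2]))
  have hopen : IsOpen (range F) := by
    rw [isOpen_iff_mem_nhds]
    rintro _ ⟨x, rfl⟩
    obtain ⟨a, rfl⟩ := QuotientAddGroup.mk_surjective x
    have hcc : Continuous (fun t : ℝ => F (t : AddCircle (q - p))) :=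
      hFc.comp (AddCircle.continuous_mk' _)
    have := nhds_le hM hcc (a := a) (r := (q - p) / 2) (by linarith) (by
      intro s hs t ht h
      have h := hFinj h
      rwa [AddCircle.coe_eq_coe_iff_of_mem_Ico (a := a - (q - p) / 2)
        ⟨by linarith [hs.1], by linarith [hs.2]⟩ ⟨by linarith [ht.1], by linarith [ht.2]⟩] at h)
    apply this
    rw [mem_map]
    exact Filter.univ_mem' fun t => ⟨_, rfl⟩
  have hcl : IsClosed (range F) := (isCompact_range hFc).isClosed
  have hu : range F = univ := IsClopen.eq_univ ⟨hcl, hopen⟩ (range_nonempty F)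
  have hbij : Bijective F := ⟨hFinj, range_eq_univ.1 hu⟩
  have e : AddCircle (q - p) ≃ₜ M :=
    Continuous.homeoOfEquivCompactToT2 (f := Equiv.ofBijective F hbij) hFc
  exact ⟨e.symm.trans (AddCircle.homeomorphCircle hT.ne')⟩

lemma glue_mono {M : Type*} [TopologicalSpace M] [T2Space M] [ConnectedSpace M] (hM : Loc M)
    (hnc : IsEmpty (M ≃ₜ Circle)) {φ ψ : ℝ → M} (hφ : IsOpenEmbedding φ) (hψ : IsOpenEmbedding ψ)
    {a d : ℝ} (had : a < d) (hd : ψ d ∉ range φ) {g : ℝ → ℝ} (hg : ∀ s ∈ Ioo a d, φ (g s) = ψ s)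
    (hgc : ContinuousOn g (Ioo a d)) (hgm : StrictMonoOn g (Ioo a d)) :
    ∃ f : ℝ → M, IsOpenEmbedding f ∧ range φ ⊆ range f ∧ ∀ s, (a + d) / 2 ≤ s → ψ s ∈ range f := by
  set t₁ := (a + d) / 2 with ht₁
  have h1 : a < t₁ := by linarith
  have h2 : t₁ < d := by linarith
  have m1 : t₁ ∈ Ioo a d := ⟨h1, h2⟩
  set u₁ := g t₁ with hu₁
  -- g is unbounded
  have hunb : ∀ B, ∃ s ∈ Ico t₁ d, B < g s := by
    intro B
    by_contra! hB
    apply hd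
    have hcl : IsClosed (φ '' Icc u₁ B) := (isCompact_Icc.image hφ.continuous).isClosed
    have hsub : ψ '' Ico t₁ d ⊆ φ '' Icc u₁ B := by
      rintro _ ⟨s, hs, rfl⟩
      have ms : s ∈ Ioo a d := ⟨by linarith [hs.1], hs.2⟩
      exact ⟨g s, ⟨hgm.monotoneOn m1 ms hs.1, hB s hs⟩, hg s ms⟩
    have hdc : d ∈ closure (Ico t₁ d) := by
      rw [closure_Ico h2.ne]; exact ⟨h2.le, le_rfl⟩
    have : ψ d ∈ φ '' Icc u₁ B :=
      closure_minimal hsub hcl (image_closure_subset_closure_image hψ.continuous ⟨d, hdc, rfl⟩)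
    exact image_subset_range _ _ this
  have hsurj : ∀ u, u₁ ≤ u → ∃ s ∈ Ico t₁ d, g s = u := by
    intro u hu
    obtain ⟨s, hs, hus⟩ := hunb u
    have hc : ContinuousOn g (Icc t₁ s) :=
      hgc.mono fun x hx => ⟨by linarith [hx.1], by linarith [hx.2, hs.2]⟩
    obtain ⟨x, hx, hxu⟩ := intermediate_value_Icc hs.1 hc ⟨hu, hus.le⟩
    exact ⟨x, ⟨hx.1, by linarith [hx.2, hs.2]⟩, hxu⟩
  let f : ℝ → M := fun t => if t ≤ 0 then φ (u₁ + t) else ψ (t₁ + t)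
  have hfc : Continuous f := by
    apply Continuous.if_le
    · exact hφ.continuous.comp (by fun_prop)
    · exact hψ.continuous.comp (by fun_prop)
    · fun_prop
    · fun_prop
    · intro x hx
      subst hx
      simp only [add_zero]
      exact hg _ m1
  have f1 : ∀ t ≤ 0, f t = φ (u₁ + t) := fun t ht => if_pos ht
  have f2 : ∀ t, 0 < t → f t = ψ (t₁ + t) := fun t ht => if_neg (not_le.2 ht)
  have f2' : ∀ t, 0 ≤ t → f t = ψ (t₁ + t) := by
    intro t ht
    rcases ht.eq_or_lt with rfl | h
    · rw [f1 _ le_rfl, add_zero, add_zero]; exact hg _ m1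
    · exact f2 t h
  have hgap : ∀ p q, p < q → f p = f q → d - t₁ ≤ q - p := by
    intro p q hpq h
    rcases le_or_gt q 0 with hq | hq
    · rw [f1 p (by linarith), f1 q hq] at h
      have := hφ.injective h
      linarith
    rcases le_or_gt 0 p with hp | hp
    · rw [f2' p hp, f2' q hq.le] at h
      have := hψ.injective h
      linarith
    by_contra! hlt
    have mq : t₁ + q ∈ Ioo a d := ⟨by linarith, by linarith⟩
    rw [f1 p hp.le, f2 q hq, ← hg _ mq] at h
    have := hφ.injective h
    have := hgm m1 mq (by linarith)
    linarith
  have hinj : Injective f := by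
    intro p q h
    by_contra hne
    rcases lt_or_gt_of_ne hne with hlt | hlt
    · exact hnc.elim (circle_of hM hfc (sub_pos.2 h2) hgap hlt h).some
    · exact hnc.elim (circle_of hM hfc (sub_pos.2 h2) hgap hlt h.symm).some
  have hfr : ∀ s, t₁ ≤ s → ψ s ∈ range f := fun s hs =>
    ⟨s - t₁, by rw [f2' _ (by linarith)]; congr 1; ring⟩
  refine ⟨f, openEmb hM hfc hinj, ?_, hfr⟩
  rintro _ ⟨u, rfl⟩
  rcases le_total u u₁ with h | h
  · exact ⟨u - u₁, by rw [f1 _ (by linarith)]; congr 1; ring⟩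
  · obtain ⟨s, hs, rfl⟩ := hsurj u h
    rw [hg s ⟨by linarith [hs.1], hs.2⟩]
    exact hfr s hs.1

lemma neg_emb {M : Type*} [TopologicalSpace M] {φ : ℝ → M} (hφ : IsOpenEmbedding φ) :
    IsOpenEmbedding (fun t => φ (-t)) :=
  hφ.comp (Homeomorph.neg ℝ).isOpenEmbedding

lemma glue_one {M : Type*} [TopologicalSpace M] [T2Space M] [ConnectedSpace M] (hM : Loc M)
    (hnc : IsEmpty (M ≃ₜ Circle)) {φ ψ : ℝ → M} (hφ : IsOpenEmbedding φ) (hψ : IsOpenEmbedding ψ)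
    {t₀ : ℝ} (ht₀ : ψ t₀ ∈ range φ) :
    ∃ f : ℝ → M, IsOpenEmbedding f ∧ range φ ⊆ range f ∧ ∀ s, t₀ ≤ s → ψ s ∈ range f := by
  by_cases hall : ∀ s, t₀ ≤ s → ψ s ∈ range φ
  · exact ⟨φ, hφ, Subset.rfl, hall⟩
  push Not at hall
  let S : Set ℝ := Ici t₀ ∩ ψ ⁻¹' (range φ)ᶜ
  have hS : IsClosed S := isClosed_Ici.inter (hφ.isOpen_range.isClosed_compl.preimage hψ.continuous)
  have hne : S.Nonempty := hall
  have hbd : BddBelow S := ⟨t₀, fun s hs => hs.1⟩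
  have hdS : sInf S ∈ S := hS.csInf_mem hne hbd
  set d := sInf S with hd
  have htd : t₀ < d := by
    refine lt_of_le_of_ne hdS.1 ?_
    intro h
    apply hdS.2
    rw [← h]; exact ht₀
  have hin : ∀ s, t₀ ≤ s → s < d → ψ s ∈ range φ := by
    intro s h1 h2
    by_contra h
    exact absurd (csInf_le hbd (show s ∈ S from ⟨h1, h⟩)) (not_le.2 h2)
  obtain ⟨γ, g1, g2, g3⟩ := exists_inv hφ
  have hg : ∀ s ∈ Ioo t₀ d, φ (γ (ψ s)) = ψ s := fun s hs => g2 _ (hin s hs.1.le hs.2)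
  have hgc : ContinuousOn (fun s => γ (ψ s)) (Ioo t₀ d) :=
    g3.comp hψ.continuous.continuousOn fun s hs => hin s hs.1.le hs.2
  have hgi : InjOn (fun s => γ (ψ s)) (Ioo t₀ d) := by
    intro s hs t ht h
    have h' : γ (ψ s) = γ (ψ t) := h
    apply hψ.injective
    rw [← hg s hs, ← hg t ht, h']
  have fin : (∃ f : ℝ → M, IsOpenEmbedding f ∧ range φ ⊆ range f ∧
      ∀ s, (t₀ + d) / 2 ≤ s → ψ s ∈ range f) := by
    rcases hgc.strictMonoOn_of_injOn_Ioo htd hgi with hm | hm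
    · exact glue_mono hM hnc hφ hψ htd hdS.2 hg hgc hm
    · have hr : range (fun t => φ (-t)) = range φ :=
        (neg_surjective (G := ℝ)).range_comp φ
      obtain ⟨f, a1, a2, a3⟩ := glue_mono hM hnc (neg_emb hφ) hψ htd (by rw [hr]; exact hdS.2)
        (g := fun s => - γ (ψ s)) (by simpa using hg) hgc.neg
        (fun s hs t ht h => neg_lt_neg (hm hs ht h))
      rw [hr] at a2
      exact ⟨f, a1, a2, a3⟩
  obtain ⟨f, a1, a2, a3⟩ := fin
  refine ⟨f, a1, a2, fun s hs => ?_⟩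
  rcases le_or_gt ((t₀ + d) / 2) s with h | h
  · exact a3 s h
  · exact a2 (hin s hs (by linarith))

lemma glue {M : Type*} [TopologicalSpace M] [T2Space M] [ConnectedSpace M] (hM : Loc M)
    (hnc : IsEmpty (M ≃ₜ Circle)) {φ ψ : ℝ → M} (hφ : IsOpenEmbedding φ) (hψ : IsOpenEmbedding ψ)
    {x : M} (h1 : x ∈ range φ) (h2 : x ∈ range ψ) :
    ∃ f : ℝ → M, IsOpenEmbedding f ∧ range φ ⊆ range f ∧ range ψ ⊆ range f := by
  obtain ⟨t₀, rfl⟩ := h2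
  obtain ⟨f, a1, a2, a3⟩ := glue_one hM hnc hφ hψ h1
  obtain ⟨f', b1, b2, b3⟩ := glue_one hM hnc a1 (neg_emb hψ) (t₀ := -t₀)
    (by simpa using a2 h1)
  refine ⟨f', b1, a2.trans b2, ?_⟩
  rintro _ ⟨s, rfl⟩
  rcases le_total t₀ s with h | h
  · exact b2 (a3 s h)
  · simpa using b3 (-s) (by linarith)

lemma glue_any {M : Type*} [TopologicalSpace M] [T2Space M] [ConnectedSpace M] (hM : Loc M)
    (hnc : IsEmpty (M ≃ₜ Circle)) {φ ψ : ℝ → M} (hφ : IsOpenEmbedding φ)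
    (hψ : IsOpenEmbedding ψ) :
    ∃ f : ℝ → M, IsOpenEmbedding f ∧ range φ ⊆ range f ∧ range ψ ⊆ range f := by
  let S : Set M := {y | ∃ f : ℝ → M, IsOpenEmbedding f ∧ φ 0 ∈ range f ∧ y ∈ range f}
  have hSo : IsOpen S := by
    rw [isOpen_iff_mem_nhds]
    rintro y ⟨f, h1, h2, h3⟩
    exact Filter.mem_of_superset (h1.isOpen_range.mem_nhds h3) fun z hz => ⟨f, h1, h2, hz⟩
  have hSc : IsClosed S := by
    rw [← isOpen_compl_iff, isOpen_iff_mem_nhds]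
    intro y hy
    obtain ⟨χ, c1, c2⟩ := hM y
    refine Filter.mem_of_superset (c1.isOpen_range.mem_nhds c2) fun z hz hzS => hy ?_
    obtain ⟨f, h1, h2, h3⟩ := hzS
    obtain ⟨f', d1, d2, d3⟩ := glue hM hnc h1 c1 h3 hz
    exact ⟨f', d1, d2 h2, d3 c2⟩
  have hu : S = univ := IsClopen.eq_univ ⟨hSc, hSo⟩ ⟨φ 0, φ, hφ, ⟨0, rfl⟩, ⟨0, rfl⟩⟩
  have : ψ 0 ∈ S := hu ▸ mem_univ _
  obtain ⟨f, h1, h2, h3⟩ := this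
  obtain ⟨f', a1, a2, a3⟩ := glue hM hnc hφ h1 ⟨0, rfl⟩ h2
  obtain ⟨f'', b1, b2, b3⟩ := glue hM hnc a1 hψ (a3 h3) ⟨0, rfl⟩
  exact ⟨f'', b1, a2.trans b2, b3⟩

lemma compact_sub {M : Type*} [TopologicalSpace M] [T2Space M] [ConnectedSpace M] (hM : Loc M)
    (hnc : IsEmpty (M ≃ₜ Circle)) {K : Set M} (hK : IsCompact K) :
    ∃ f : ℝ → M, IsOpenEmbedding f ∧ K ⊆ range f := by
  refine hK.induction_on (p := fun K => ∃ f : ℝ → M, IsOpenEmbedding f ∧ K ⊆ range f) ?_ ?_ ?_ ?_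
  · obtain ⟨f, h1, _⟩ := hM (Classical.arbitrary M)
    exact ⟨f, h1, empty_subset _⟩
  · rintro s t hst ⟨f, h1, h2⟩
    exact ⟨f, h1, hst.trans h2⟩
  · rintro s t ⟨f, h1, h2⟩ ⟨f', h1', h2'⟩
    obtain ⟨f'', a1, a2, a3⟩ := glue_any hM hnc h1 h1'
    exact ⟨f'', a1, union_subset (h2.trans a2) (h2'.trans a3)⟩
  · intro x _
    obtain ⟨f, h1, h2⟩ := hM x
    exact ⟨range f, mem_nhdsWithin_of_mem_nhds (h1.isOpen_range.mem_nhds h2), f, h1, Subset.rfl⟩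

lemma step_mono {M : Type*} [TopologicalSpace M] {f φ : ℝ → M}
    (hφ : IsOpenEmbedding φ) {a : ℝ} (ha : 0 ≤ a) {K : Set M} (hK : IsCompact K)
    (hKφ : K ⊆ range φ) {g : ℝ → ℝ} (hg : ∀ s ∈ Icc (-a) a, φ (g s) = f s)
    (hgc : ContinuousOn g (Icc (-a) a)) (hgm : StrictMonoOn g (Icc (-a) a)) :
    ∃ f' : ℝ → M, Continuous f' ∧ Injective f' ∧ EqOn f f' (Icc (-a) a) ∧
      K ⊆ f' '' Icc (-(a + 1)) (a + 1) := by
  have haa : -a ≤ a := by linarith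
  obtain ⟨γ, g1, g2, g3⟩ := exists_inv hφ
  have hKc : IsCompact (γ '' K) := hK.image_of_continuousOn (g3.mono hKφ)
  obtain ⟨R, hR⟩ := hKc.isBounded.subset_closedBall 0
  set c : ℝ := |R| + |g a| + |g (-a)| + 1 with hc
  have hc0 : 0 < c := by positivity
  let p : ℝ → ℝ := fun t => max (-a) (min a t)
  have hpm : ∀ t, p t ∈ Icc (-a) a := fun t => ⟨le_max_left _ _, max_le haa (min_le_left _ _)⟩
  have hpc : Continuous p := by fun_prop
  have hpe : ∀ t ∈ Icc (-a) a, p t = t := by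
    intro t ht
    simp only [p]
    rw [min_eq_right ht.2, max_eq_right ht.1]
  have hpmono : Monotone p := by
    intro s t h
    exact max_le_max le_rfl (min_le_min le_rfl h)
  have hplip : ∀ s t, s ≤ t → p t - p s ≤ t - s := by
    intro s t h
    simp only [p]
    rcases max_cases (-a) (min a t) with h1 | h1 <;> rcases max_cases (-a) (min a s) with h2 | h2 <;>
      rcases min_cases a t with h3 | h3 <;> rcases min_cases a s with h4 | h4 <;> linarith
  let h : ℝ → ℝ := fun t => g (p t) + c * (t - p t)
  have hhc : Continuous h := by
    have : Continuous fun t => g (p t) := hgc.comp_continuous hpc hpm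
    exact this.add (continuous_const.mul (continuous_id.sub hpc))
  have hhm : StrictMono h := by
    intro s t hst
    simp only [h]
    have e1 := hplip s t hst.le
    rcases (hpmono hst.le).eq_or_lt with e | e
    · rw [e]; nlinarith
    · have := hgm (hpm s) (hpm t) e
      nlinarith
  have hmid : ∀ t ∈ Icc (-a) a, h t = g t := by
    intro t ht
    simp only [h, hpe t ht]; ring
  refine ⟨fun t => φ (h t), hφ.continuous.comp hhc, hφ.injective.comp hhm.injective, ?_, ?_⟩
  · intro t ht
    simp only [hmid t ht, hg t ht]
  · intro y hy
    have hy' : γ y ∈ Metric.closedBall (0:ℝ) R := hR ⟨y, hy, rfl⟩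
    rw [Metric.mem_closedBall, dist_zero_right, Real.norm_eq_abs, abs_le] at hy'
    have k1 : h (a + 1) = g a + c := by
      have : p (a + 1) = a := by
        simp only [p]; rw [min_eq_left (by linarith), max_eq_right haa]
      simp only [h, this]; ring
    have k2 : h (-(a + 1)) = g (-a) - c := by
      have : p (-(a + 1)) = -a := by
        simp only [p]; rw [min_eq_right (by linarith), max_eq_left (by linarith)]
      simp only [h, this]; ring
    have := le_abs_self R
    have := neg_abs_le (g a)
    have := le_abs_self (g (-a))
    have := abs_nonneg (g a)
    have := abs_nonneg (g (-a))
    obtain ⟨t, ht, hty⟩ := intermediate_value_Icc (show -(a + 1) ≤ a + 1 by linarith)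
      hhc.continuousOn (show γ y ∈ Icc (h (-(a + 1))) (h (a + 1)) from
        ⟨by rw [k2]; linarith, by rw [k1]; linarith⟩)
    refine ⟨t, ht, ?_⟩
    simp only [hty]
    exact g2 _ (hKφ hy)

lemma step {M : Type*} [TopologicalSpace M] [T2Space M] [ConnectedSpace M] (hM : Loc M)
    (hnc : IsEmpty (M ≃ₜ Circle)) {f : ℝ → M} (hf : Continuous f) (hfi : Injective f)
    {a : ℝ} (ha : 0 ≤ a) {K : Set M} (hK : IsCompact K) :
    ∃ f' : ℝ → M, Continuous f' ∧ Injective f' ∧ EqOn f f' (Icc (-a) a) ∧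
      K ⊆ f' '' Icc (-(a + 1)) (a + 1) := by
  obtain ⟨φ, hφ, hsub⟩ := compact_sub hM hnc (hK.union ((isCompact_Icc (a := -a) (b := a)).image hf))
  have hKφ : K ⊆ range φ := subset_union_left.trans hsub
  have hin : ∀ s ∈ Icc (-a) a, f s ∈ range φ := fun s hs => hsub (Or.inr ⟨s, hs, rfl⟩)
  obtain ⟨γ, g1, g2, g3⟩ := exists_inv hφ
  have hg : ∀ s ∈ Icc (-a) a, φ (γ (f s)) = f s := fun s hs => g2 _ (hin s hs)
  have hgc : ContinuousOn (fun s => γ (f s)) (Icc (-a) a) := g3.comp hf.continuousOn hin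
  have hgi : InjOn (fun s => γ (f s)) (Icc (-a) a) := by
    intro s hs t ht h
    have h' : γ (f s) = γ (f t) := h
    apply hfi
    rw [← hg s hs, ← hg t ht, h']
  rcases hgc.strictMonoOn_of_injOn_Icc' (by linarith) hgi with hm | hm
  · exact step_mono hφ ha hK hKφ hg hgc hm
  · have hr : range (fun t => φ (-t)) = range φ :=
      (neg_surjective (G := ℝ)).range_comp φ
    exact step_mono (neg_emb hφ) ha hK (by rw [hr]; exact hKφ)
      (g := fun s => - γ (f s)) (by simpa using hg) hgc.neg
      (fun s hs t ht h => neg_lt_neg (hm hs ht h))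

lemma line {M : Type*} [TopologicalSpace M] [T2Space M] [ConnectedSpace M] [SigmaCompactSpace M]
    (hM : Loc M) (hnc : IsEmpty (M ≃ₜ Circle)) :
    ∃ f : ℝ → M, IsOpenEmbedding f ∧ Surjective f := by
  obtain ⟨f₀, h0, _⟩ := hM (Classical.arbitrary M)
  choose nx n1 n2 n3 n4 using fun (F : {f : ℝ → M // Continuous f ∧ Injective f}) (n : ℕ) =>
    step hM hnc F.2.1 F.2.2 (Nat.cast_nonneg n) (isCompact_compactCovering M n)
  let G : ℕ → {f : ℝ → M // Continuous f ∧ Injective f} := fun n =>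
    Nat.rec ⟨f₀, h0.continuous, h0.injective⟩ (fun n F => ⟨nx F n, n1 F n, n2 F n⟩) n
  have G1 : ∀ n : ℕ, EqOn (G n).1 (G (n + 1)).1 (Icc (-(n : ℝ)) n) := fun n => n3 (G n) n
  have G2 : ∀ n : ℕ, compactCovering M n ⊆ (G (n + 1)).1 '' Icc (-((n : ℝ) + 1)) (n + 1) :=
    fun n => n4 (G n) n
  have G3 : ∀ n m : ℕ, n ≤ m → EqOn (G n).1 (G m).1 (Icc (-(n : ℝ)) n) := by
    intro n m hnm
    induction m, hnm using Nat.le_induction with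
    | base => exact fun _ _ => rfl
    | succ m hm ih =>
      have : (n : ℝ) ≤ m := by exact_mod_cast hm
      exact ih.trans ((G1 m).mono (Icc_subset_Icc (by linarith) this))
  let f : ℝ → M := fun t => (G ⌈|t|⌉₊).1 t
  have hf : ∀ (n : ℕ), ∀ t ∈ Icc (-(n : ℝ)) n, f t = (G n).1 t := by
    intro n t ht
    apply G3 _ n
    · exact Nat.ceil_le.2 (abs_le.2 ht)
    · exact abs_le.1 (Nat.le_ceil _)
  have hfc : Continuous f := by
    rw [continuous_iff_continuousAt]
    intro t
    obtain ⟨n, hn⟩ := exists_nat_gt |t|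
    rw [abs_lt] at hn
    refine ((G n).2.1.continuousAt).congr ?_
    filter_upwards [Ioo_mem_nhds hn.1 hn.2] with s hs
    exact (hf n s ⟨hs.1.le, hs.2.le⟩).symm
  have hfi : Injective f := by
    intro s t h
    obtain ⟨n, hn⟩ := exists_nat_gt (max |s| |t|)
    have hs := abs_le.1 ((le_max_left _ _).trans hn.le)
    have ht := abs_le.1 ((le_max_right _ _).trans hn.le)
    rw [hf n s hs, hf n t ht] at h
    exact (G n).2.2 h
  refine ⟨f, openEmb hM hfc hfi, ?_⟩
  intro y
  obtain ⟨n, hn⟩ := exists_mem_compactCovering y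
  obtain ⟨t, ht, rfl⟩ := G2 n hn
  exact ⟨t, hf (n + 1) t (by push_cast; exact ht)⟩

lemma real_homeo : Nonempty (ℝ ≃ₜ ↥(Set.Ioo (0 : ℝ) 1)) := by
  have hr : range Real.sigmoid = Ioo 0 1 := Real.range_sigmoid
  have he : IsEmbedding Real.sigmoid :=
    Real.sigmoid_strictMono.isEmbedding_of_ordConnected (by rw [hr]; exact ordConnected_Ioo)
  exact ⟨he.toHomeomorph.trans (Homeomorph.setCongr hr)⟩

lemma chart {X : Type*} [TopologicalSpace X] {V : Set X} (hV : IsWitness X V) {x : X}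
    (hx : x ∉ V) : ∃ ψ : ℝ → X, IsOpenEmbedding ψ ∧ x ∈ range ψ ∧ range ψ ⊆ Vᶜ := by
  obtain ⟨hc, _, E, hE⟩ := hV
  letI : TopologicalSpace E := ⊥
  haveI : DiscreteTopology E := ⟨rfl⟩
  obtain ⟨h⟩ := hE
  obtain ⟨κ⟩ := real_homeo
  let z := h ⟨x, hx⟩
  have h1 : IsOpenEmbedding (fun t : ↥(Set.Ioo (0 : ℝ) 1) => (z.1, t)) := by
    refine IsOpenEmbedding.of_continuous_injective_isOpenMap (by fun_prop)
      (fun a b h => (Prod.ext_iff.1 h).2) ?_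
    intro U hU
    have : (fun t : ↥(Set.Ioo (0 : ℝ) 1) => (z.1, t)) '' U = {z.1} ×ˢ U := by
      ext ⟨a, b⟩
      constructor
      · rintro ⟨t, ht, h⟩
        obtain ⟨h1, h2⟩ := Prod.ext_iff.1 h
        exact ⟨h1.symm, by rw [← show t = b from h2]; exact ht⟩
      · rintro ⟨h1, h2⟩
        exact ⟨b, h2, Prod.ext (show a = z.1 from h1).symm rfl⟩
    rw [this]
    exact (isOpen_discrete _).prod hU
  have h2 : IsOpenEmbedding (Subtype.val : (Vᶜ : Set X) → X) :=
    hc.isOpen_compl.isOpenEmbedding_subtypeVal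
  refine ⟨fun t => (h.symm (z.1, κ t) : X),
    h2.comp (h.symm.isOpenEmbedding.comp (h1.comp κ.isOpenEmbedding)), ?_, ?_⟩
  · refine ⟨κ.symm z.2, ?_⟩
    simp [z]
  · rintro _ ⟨t, rfl⟩
    exact (h.symm (z.1, κ t)).2

lemma comp_line {X : Type*} [TopologicalSpace X] [CompactSpace X]
    [TopologicalSpace.MetrizableSpace X] [ConnectedSpace X] (hnc : IsEmpty (X ≃ₜ Circle))
    {U : Set X} (hU : ∀ x ∈ U, ∃ ψ : ℝ → X, IsOpenEmbedding ψ ∧ x ∈ range ψ ∧ range ψ ⊆ U)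
    {x : X} (hx : x ∈ U) :
    ∃ f : ℝ → X, IsOpenEmbedding f ∧ range f = connectedComponentIn U x := by
  set C := connectedComponentIn U x with hC
  have hch : ∀ y ∈ C, ∃ ψ : ℝ → X, IsOpenEmbedding ψ ∧ y ∈ range ψ ∧ range ψ ⊆ C := by
    intro y hy
    obtain ⟨ψ, h1, h2, h3⟩ := hU y (connectedComponentIn_subset _ _ hy)
    refine ⟨ψ, h1, h2, ?_⟩
    rw [hC, connectedComponentIn_eq hy]
    exact (isPreconnected_range h1.continuous).subset_connectedComponentIn h2 h3
  have hCo : IsOpen C := by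
    rw [isOpen_iff_mem_nhds]
    intro y hy
    obtain ⟨ψ, h1, h2, h3⟩ := hch y hy
    exact Filter.mem_of_superset (h1.isOpen_range.mem_nhds h2) h3
  have hval : IsOpenEmbedding (Subtype.val : C → X) := hCo.isOpenEmbedding_subtypeVal
  have hconn : ConnectedSpace C :=
    isConnected_iff_connectedSpace.1 (isConnected_connectedComponentIn_iff.2 hx)
  have hLoc : Loc C := by
    rintro ⟨y, hy⟩
    obtain ⟨ψ, h1, ⟨t, ht⟩, h3⟩ := hch y hy
    refine ⟨fun t => ⟨ψ t, h3 ⟨t, rfl⟩⟩, ?_, ⟨t, Subtype.ext ht⟩⟩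
    exact IsOpenEmbedding.of_comp _ hval (by exact h1)
  have hncC : IsEmpty (C ≃ₜ Circle) := by
    constructor
    intro e
    have hcs : CompactSpace C := e.symm.compactSpace
    have hcc : IsCompact C := isCompact_iff_compactSpace.2 hcs
    have hu : C = univ := IsClopen.eq_univ ⟨hcc.isClosed, hCo⟩ ⟨x, mem_connectedComponentIn hx⟩
    exact hnc.elim (((Homeomorph.setCongr hu).trans (Homeomorph.Set.univ X)).symm.trans e)
  letI := TopologicalSpace.metrizableSpaceMetric X
  have : LocallyCompactSpace C := hCo.locallyCompactSpace
  have : SecondCountableTopology C := inferInstance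
  obtain ⟨f, h1, h2⟩ := line hLoc hncC
  refine ⟨fun t => (f t : X), hval.comp h1, ?_⟩
  have : (fun t => (f t : X)) = Subtype.val ∘ f := rfl
  rw [this, range_comp, h2.range_eq, image_univ, Subtype.range_coe]

lemma union_homeo {X : Type*} [TopologicalSpace X] [CompactSpace X]
    [TopologicalSpace.MetrizableSpace X] [ConnectedSpace X] (hnc : IsEmpty (X ≃ₜ Circle))
    {U : Set X} (hU : ∀ x ∈ U, ∃ ψ : ℝ → X, IsOpenEmbedding ψ ∧ x ∈ range ψ ∧ range ψ ⊆ U) :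
    ∃ E : Type,
      letI : TopologicalSpace E := ⊥
      Nonempty (U ≃ₜ (E × ↥(Set.Ioo (0 : ℝ) 1))) := by
  let 𝓒 : Set (Set X) := {C | ∃ x ∈ U, C = connectedComponentIn U x}
  have hf : ∀ C : 𝓒, ∃ f : ℝ → X, IsOpenEmbedding f ∧ range f = C.1 := by
    rintro ⟨_, x, hx, rfl⟩
    exact comp_line hnc hU hx
  choose f f1 f2 using hf
  have hdis : ∀ C D : 𝓒, ∀ y, y ∈ C.1 → y ∈ D.1 → C = D := by
    rintro ⟨_, x, hx, rfl⟩ ⟨_, x', hx', rfl⟩ y h1 h2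
    apply Subtype.ext
    show connectedComponentIn U x = connectedComponentIn U x'
    rw [connectedComponentIn_eq h1, connectedComponentIn_eq h2]
  letI := TopologicalSpace.metrizableSpaceMetric X
  have hcount : Countable 𝓒 := by
    refine Pairwise.countable_of_isOpen_disjoint (s := fun C : 𝓒 => C.1) ?_ ?_ ?_
    · intro C D hne
      rw [Function.onFun, Set.disjoint_left]
      exact fun y h1 h2 => hne (hdis C D y h1 h2)
    · intro C
      rw [← f2 C]; exact (f1 C).isOpen_range
    · intro C
      rw [← f2 C]; exact range_nonempty _
  have hsm : Small.{0} 𝓒 := Countable.toSmall 𝓒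
  let eE : 𝓒 ≃ Shrink.{0} 𝓒 := equivShrink.{0} 𝓒
  obtain ⟨κ⟩ := real_homeo
  refine ⟨Shrink.{0} 𝓒, ?_⟩
  letI tE : TopologicalSpace (Shrink.{0} 𝓒) := ⊥
  have dE : DiscreteTopology (Shrink.{0} 𝓒) := ⟨rfl⟩
  have hin : ∀ C : 𝓒, ∀ t, f C t ∈ U := by
    intro C t
    have h : f C t ∈ C.1 := by rw [← f2 C]; exact ⟨t, rfl⟩
    obtain ⟨x, hx, hC⟩ := C.2
    rw [hC] at h
    exact connectedComponentIn_subset _ _ h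
  let F : Shrink.{0} 𝓒 × ↥(Set.Ioo (0 : ℝ) 1) → U :=
    fun z => ⟨f (eE.symm z.1) (κ.symm z.2), hin _ _⟩
  have hFc : Continuous F := by
    rw [continuous_prod_of_discrete_left]
    intro a
    exact ((f1 (eE.symm a)).continuous.comp κ.symm.continuous).subtype_mk _
  have hFo : IsOpenMap F := by
    rw [isOpenMap_prod_of_discrete_left]
    intro a
    have h1 : IsOpenMap (fun t : ↥(Set.Ioo (0 : ℝ) 1) => f (eE.symm a) (κ.symm t)) :=
      (f1 (eE.symm a)).isOpenMap.comp κ.symm.isOpenMap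
    exact h1.subtype_mk _
  have hFb : Bijective F := by
    constructor
    · rintro ⟨a, s⟩ ⟨b, t⟩ h
      have h : f (eE.symm a) (κ.symm s) = f (eE.symm b) (κ.symm t) := congrArg Subtype.val h
      have hab : eE.symm a = eE.symm b := by
        apply hdis _ _ (f (eE.symm a) (κ.symm s))
        · rw [← f2]; exact ⟨_, rfl⟩
        · rw [h, ← f2]; exact ⟨_, rfl⟩
      have hab := eE.symm.injective hab
      subst hab
      have := κ.symm.injective ((f1 _).injective h)
      rw [this]
    · rintro ⟨y, hy⟩
      let C : 𝓒 := ⟨connectedComponentIn U y, y, hy, rfl⟩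
      have : y ∈ range (f C) := by rw [f2]; exact mem_connectedComponentIn hy
      obtain ⟨t, ht⟩ := this
      refine ⟨(eE C, κ t), Subtype.ext ?_⟩
      simp [F, ht]
  exact ⟨((Equiv.ofBijective F hFb).toHomeomorphOfContinuousOpen hFc hFo).symm⟩

end MinWit

/-- For a graph-like continuum not homeomorphic to the circle, the
intersection of all witnessing vertex sets is itself a witness; in particular there is a
unique minimal vertex set witnessing that `X` is graph-like. -/
theorem exists_minimal_witness
    [CompactSpace X] [TopologicalSpace.MetrizableSpace X] [ConnectedSpace X]
    (hgl : ∃ V, IsWitness X V) (hnc : IsEmpty (X ≃ₜ Circle)) :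
    IsWitness X (⋂₀ {V | IsWitness X V}) ∧
    ∀ V, IsWitness X V → ⋂₀ {V | IsWitness X V} ⊆ V := by
  refine ⟨⟨?_, ?_, ?_⟩, fun V hV => sInter_subset_of_mem hV⟩
  · exact isClosed_sInter fun V hV => hV.1
  · obtain ⟨V, hV⟩ := hgl
    have h1 : IsTotallyDisconnected V := totallyDisconnectedSpace_subtype_iff.1 hV.2.1
    have h2 : IsTotallyDisconnected (⋂₀ {V | IsWitness X V}) :=
      fun t ht => h1 t (ht.trans (sInter_subset_of_mem hV))
    exact totallyDisconnectedSpace_subtype_iff.2 h2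
  · apply MinWit.union_homeo hnc
    intro x hx
    obtain ⟨V, hV, hxV⟩ : ∃ V, IsWitness X V ∧ x ∉ V := by
      by_contra! h
      exact hx fun V hV => h V hV
    obtain ⟨ψ, h1, h2, h3⟩ := MinWit.chart hV hxV
    exact ⟨ψ, h1, h2, h3.trans (compl_subset_compl.2 (sInter_subset_of_mem hV))⟩
end
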